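/- Suppose k ≥ 2 and set R = max{ ‖z − p − π(z)·v‖ : z ∈ {y_1,…,y_ℓ} ∪ {x_1,…,x_k} }. If for some i ∈ {1,…,k} one has |π(x_i) − π(y_j)| > 2·C·R + min_{i*≠i} |π(x_{i*}) − π(y_j)| for every j ∈ {1,…,ℓ}, then S^{-1}(i) = ∅ for every optimal assignment map S. -/

import Mathlib

open scoped BigOperators RealInnerProductSpace

noncomputable section

attribute [local instance] Classical.propDecidable

/-- Points of the ambient Euclidean space `ℝ^m`. -/
abbrev Pt (m : ℕ) := EuclideanSpace ℝ (Fin m)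

/-- A weighted directed graph in `ℝ^m`: a finite vertex set, a finite set of
directed edges (ordered pairs of points, viewed as directed line segments), and
a weight function. -/
structure WDG (m : ℕ) where
  V : Finset (Pt m)
  E : Finset (Pt m × Pt m)
  w : Pt m × Pt m → ℝ

namespace WDG

variable {m : ℕ}

/-- Edges join distinct vertices of the graph and carry positive weight. -/
def edgesOK (G : WDG m) : Prop :=
  ∀ e ∈ G.E, e.1 ∈ G.V ∧ e.2 ∈ G.V ∧ e.1 ≠ e.2 ∧ 0 < G.w e

/-- The underlying undirected (simple) graph. -/
def undirected (G : WDG m) : SimpleGraph (Pt m) :=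
  SimpleGraph.fromRel (fun u v => (u, v) ∈ G.E)

/-- The cost `M_α(G) = Σ_{e ∈ E(G)} w(e)^α · length(e)`. -/
def cost (α : ℝ) (G : WDG m) : ℝ :=
  ∑ e ∈ G.E, (G.w e) ^ α * dist e.1 e.2

/-- Total weight of edges starting at `v`. -/
def outflow (G : WDG m) (v : Pt m) : ℝ :=
  ∑ e ∈ G.E.filter (fun e => e.1 = v), G.w e

/-- Total weight of edges ending at `v`. -/
def inflow (G : WDG m) (v : Pt m) : ℝ :=
  ∑ e ∈ G.E.filter (fun e => e.2 = v), G.w e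

end WDG

/-- Atomic measures are represented as finitely supported functions `ℝ^m →₀ ℝ`
with nonnegative values; `AtomicOn X c` also requires the atoms to lie in `X`. -/
def AtomicOn {m : ℕ} (X : Set (Pt m)) (c : Pt m →₀ ℝ) : Prop :=
  (∀ z, 0 ≤ c z) ∧ ↑c.support ⊆ X

/-- The mass `m(c)` of an atomic measure. -/
def massOf {m : ℕ} (c : Pt m →₀ ℝ) : ℝ := c.sum fun _ t => t

/-- `G` is a transport path from `a` to `b` inside `X`: its vertices lie in `X`
and contain the atoms of `a` and `b`, its underlying undirected graph has no
cycles, and the balance equation holds at every vertex. -/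
def IsTransportPath {m : ℕ} (X : Set (Pt m)) (G : WDG m) (a b : Pt m →₀ ℝ) : Prop :=
  G.edgesOK ∧ ↑G.V ⊆ X ∧
  (∀ z ∈ a.support, z ∈ G.V) ∧ (∀ z ∈ b.support, z ∈ G.V) ∧
  G.undirected.IsAcyclic ∧
  ∀ v : Pt m, G.outflow v - G.inflow v = a v - b v

/-- `d_α(a,b)`: the minimal cost of a transport path from `a` to `b`. -/
def dCost {m : ℕ} (X : Set (Pt m)) (α : ℝ) (a b : Pt m →₀ ℝ) : ℝ :=
  sInf (WDG.cost α '' {G : WDG m | IsTransportPath X G a b})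

/-- An optimal transport path from `a` to `b`. -/
def IsOptimalTP {m : ℕ} (X : Set (Pt m)) (α : ℝ) (G : WDG m) (a b : Pt m →₀ ℝ) : Prop :=
  IsTransportPath X G a b ∧
    ∀ G' : WDG m, IsTransportPath X G' a b → WDG.cost α G ≤ WDG.cost α G'

/-- The atomic probability measure `b = Σ_j n_j δ_{y_j}` of households. -/
def bMeas {m ℓ : ℕ} (y : Fin ℓ → Pt m) (n : Fin ℓ → ℝ) : Pt m →₀ ℝ :=
  ∑ j, Finsupp.single (y j) (n j)

/-- An allocation path from the factory locations `x` to the households `(y,n)`: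
a transport path to `b` from some atomic probability measure supported on the
factory locations. -/
def IsAllocPath {m k ℓ : ℕ} (X : Set (Pt m)) (x : Fin k → Pt m)
    (y : Fin ℓ → Pt m) (n : Fin ℓ → ℝ) (G : WDG m) : Prop :=
  ∃ a : Pt m →₀ ℝ, (∀ z, 0 ≤ a z) ∧ ↑a.support ⊆ Set.range x ∧ massOf a = 1 ∧
    IsTransportPath X G a (bMeas y n)

/-- An optimal allocation path: it minimizes `M_α` over all allocation paths. -/
def IsOptimalAllocPath {m k ℓ : ℕ} (X : Set (Pt m)) (α : ℝ) (x : Fin k → Pt m)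
    (y : Fin ℓ → Pt m) (n : Fin ℓ → ℝ) (G : WDG m) : Prop :=
  IsAllocPath X x y n G ∧
    ∀ G' : WDG m, IsAllocPath X x y n G' → WDG.cost α G ≤ WDG.cost α G'

/-- For an assignment map `S`, the part `b_i = Σ_{j : S(j) = i} n_j δ_{y_j}`. -/
def bPart {m k ℓ : ℕ} (y : Fin ℓ → Pt m) (n : Fin ℓ → ℝ) (S : Fin ℓ → Fin k)
    (i : Fin k) : Pt m →₀ ℝ :=
  ∑ j ∈ Finset.univ.filter (fun j => S j = i), Finsupp.single (y j) (n j)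

/-- The mass `m(b_i) = Σ_{j : S(j) = i} n_j`. -/
def mB {k ℓ : ℕ} (n : Fin ℓ → ℝ) (S : Fin ℓ → Fin k) (i : Fin k) : ℝ :=
  ∑ j ∈ Finset.univ.filter (fun j => S j = i), n j

/-- `E_α(S) = Σ_i d_α(m(b_i) δ_{x_i}, b_i)`. -/
def Ealpha {m k ℓ : ℕ} (X : Set (Pt m)) (α : ℝ) (x : Fin k → Pt m)
    (y : Fin ℓ → Pt m) (n : Fin ℓ → ℝ) (S : Fin ℓ → Fin k) : ℝ :=
  ∑ i, dCost X α (Finsupp.single (x i) (mB n S i)) (bPart y n S i)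

/-- An optimal assignment map minimizes `E_α` over all assignment maps. -/
def IsOptimalAssign {m k ℓ : ℕ} (X : Set (Pt m)) (α : ℝ) (x : Fin k → Pt m)
    (y : Fin ℓ → Pt m) (n : Fin ℓ → ℝ) (S : Fin ℓ → Fin k) : Prop :=
  ∀ S' : Fin ℓ → Fin k, Ealpha X α x y n S ≤ Ealpha X α x y n S'

/-- `ρ_α(σ,ε)`: equals `(σ/ε)^α − (σ/ε − 1)^α` for `σ > ε` (and for `σ = ε` when
`α ∈ (0,1)`), and equals `1` when `σ = ε` (covering also the convention for `α = 0`). -/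
def rho (α σ ε : ℝ) : ℝ :=
  if σ = ε then 1 else (σ / ε) ^ α - (σ / ε - 1) ^ α


/-- `G` is the disjoint union of the subgraphs `Gi`: the `Gi` have pairwise
disjoint vertex sets, each is a subgraph of `G` (with matching weights), and
the edges of `G` are exactly the (disjoint) union of their edges. -/
def IsDisjointUnion {m k : ℕ} (G : WDG m) (Gi : Fin k → WDG m) : Prop :=
  (∀ i i' : Fin k, i ≠ i' → Disjoint (Gi i).V (Gi i').V) ∧
  (∀ i, (Gi i).V ⊆ G.V) ∧
  (∀ i, (Gi i).E ⊆ G.E) ∧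
  (∀ i, ∀ e ∈ (Gi i).E, (Gi i).w e = G.w e) ∧
  G.E = Finset.univ.biUnion (fun i => (Gi i).E)

/-- The projection coordinate `π(z) = ⟨z − p, v⟩` along the line through `p`
in direction `v`. -/
def proj {m : ℕ} (p v z : Pt m) : ℝ := ⟪z - p, v⟫

/-- The constant `C = √(m−1)/(2^{1−(m−1)(1−α)} − 1) + 1`. -/
def Cconst (m : ℕ) (α : ℝ) : ℝ :=
  Real.sqrt ((m : ℝ) - 1) / ((2 : ℝ) ^ (1 - ((m : ℝ) - 1) * (1 - α)) - 1) + 1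



section ConcavePower

/-- The power `t ^ α` with the convention that it vanishes at `t = 0` (also when `α = 0`). -/
def phi (α t : ℝ) : ℝ := if t = 0 then 0 else t ^ α

@[simp] theorem phi_zero (α : ℝ) : phi α 0 = 0 := by simp [phi]

theorem phi_of_ne {α t : ℝ} (h : t ≠ 0) : phi α t = t ^ α := by simp [phi, h]

theorem phi_nonneg {α t : ℝ} (ht : 0 ≤ t) : 0 ≤ phi α t := by
  unfold phi
  split_ifs
  · exact le_rfl
  · exact Real.rpow_nonneg ht α

theorem phi_pos {α t : ℝ} (ht : 0 < t) : 0 < phi α t := by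
  rw [phi_of_ne ht.ne']
  exact Real.rpow_pos_of_pos ht α

theorem phi_le_rpow {α t : ℝ} (ht : 0 ≤ t) : phi α t ≤ t ^ α := by
  unfold phi
  split_ifs
  · exact Real.rpow_nonneg ht α
  · exact le_rfl

theorem phi_mono {α s t : ℝ} (hα : 0 ≤ α) (hs : 0 ≤ s) (hst : s ≤ t) : phi α s ≤ phi α t := by
  rcases hs.eq_or_lt with rfl | hs'
  · rw [phi_zero]
    exact phi_nonneg hst
  · rw [phi_of_ne hs'.ne', phi_of_ne (hs'.trans_le hst).ne']
    exact Real.rpow_le_rpow hs hst hα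

theorem phi_add_le {α s t : ℝ} (hα : 0 ≤ α) (hα1 : α ≤ 1) (hs : 0 ≤ s) (ht : 0 ≤ t) :
    phi α (s + t) ≤ phi α s + phi α t := by
  rcases hs.eq_or_lt with rfl | hs'
  · simp
  rcases ht.eq_or_lt with rfl | ht'
  · simp
  rw [phi_of_ne hs'.ne', phi_of_ne ht'.ne', phi_of_ne (add_pos hs' ht').ne']
  exact Real.rpow_add_le_add_rpow hs ht hα hα1

theorem phi_eq_rpow_sub_one_mul {α t : ℝ} (ht : 0 ≤ t) : phi α t = t ^ (α - 1) * t := by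
  rcases ht.eq_or_lt with rfl | ht'
  · simp
  · rw [phi_of_ne ht'.ne', ← Real.rpow_add_one ht'.ne']
    simp

theorem rpow_sub_one_mul_le_phi {α t W : ℝ} (hα1 : α ≤ 1) (ht : 0 ≤ t) (htW : t ≤ W) :
    W ^ (α - 1) * t ≤ phi α t := by
  rw [phi_eq_rpow_sub_one_mul ht]
  rcases ht.eq_or_lt with rfl | ht'
  · simp
  · exact mul_le_mul_of_nonneg_right
      (Real.rpow_le_rpow_of_nonpos ht' htW (by linarith)) ht

theorem sum_phi_le {ι : Type*} {α : ℝ} (hα : 0 ≤ α) (hα1 : α ≤ 1) (s : Finset ι) (f : ι → ℝ)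
    (hf : ∀ i ∈ s, 0 ≤ f i) :
    ∑ i ∈ s, phi α (f i) ≤ (s.card : ℝ) ^ (1 - α) * phi α (∑ i ∈ s, f i) := by
  by_cases h0 : ∑ i ∈ s, f i = 0
  · have := (Finset.sum_eq_zero_iff_of_nonneg hf).1 h0
    rw [h0, phi_zero, mul_zero]
    refine (Finset.sum_eq_zero fun i hi => ?_).le
    rw [this i hi, phi_zero]
  have hs : s.Nonempty := by
    rw [Finset.nonempty_iff_ne_empty]
    rintro rfl
    simp at h0
  have hc : (0 : ℝ) < s.card := by exact_mod_cast hs.card_pos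
  have hJ := (Real.concaveOn_rpow hα hα1).le_map_sum (t := s) (w := fun _ => (s.card : ℝ)⁻¹)
    (p := f) (fun _ _ => by positivity) (by simp [hc.ne']) (fun i hi => hf i hi)
  simp only [smul_eq_mul, ← Finset.mul_sum] at hJ
  have hS : 0 ≤ ∑ i ∈ s, f i := Finset.sum_nonneg hf
  rw [Real.mul_rpow (by positivity) hS, inv_mul_le_iff₀ hc, Real.inv_rpow hc.le] at hJ
  rw [phi_of_ne h0, Real.rpow_sub hc, Real.rpow_one]
  calc ∑ i ∈ s, phi α (f i) ≤ ∑ i ∈ s, f i ^ α :=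
        Finset.sum_le_sum fun i hi => phi_le_rpow (hf i hi)
    _ ≤ _ := hJ.trans_eq (by rw [div_eq_mul_inv]; ring)

end ConcavePower

section Flow

variable {V : Type*}

/-- The boundary `Σ w(e) (δ_{e.1} - δ_{e.2})` of a weighted family of directed edges. -/
def bdry : (V × V →₀ ℝ) →ₗ[ℝ] (V →₀ ℝ) :=
  Finsupp.linearCombination ℝ fun e => Finsupp.single e.1 1 - Finsupp.single e.2 1

theorem bdry_single (e : V × V) (t : ℝ) :
    bdry (Finsupp.single e t) = Finsupp.single e.1 t - Finsupp.single e.2 t := by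
  simp [bdry, smul_sub]

theorem linearCombination_bdry (h : V → ℝ) (w : V × V →₀ ℝ) :
    Finsupp.linearCombination ℝ h (bdry w) =
      Finsupp.linearCombination ℝ (fun e : V × V => h e.1 - h e.2) w := by
  induction w using Finsupp.induction_linear with
  | zero => simp
  | add f g hf hg => simp only [map_add, hf, hg]
  | single e t => simp [bdry_single, mul_sub]

theorem sum_bdry_mul (h : V → ℝ) (w : V × V →₀ ℝ) :
    ((bdry w).sum fun z t => t * h z) = ∑ e ∈ w.support, w e * (h e.1 - h e.2) := by
  have := linearCombination_bdry h w
  rwa [Finsupp.linearCombination_apply, Finsupp.linearCombination_apply] at this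

theorem bdry_apply {w : V × V →₀ ℝ} {s : Finset (V × V)} (hs : w.support ⊆ s) (z : V) :
    bdry w z = ∑ e ∈ s with e.1 = z, w e - ∑ e ∈ s with e.2 = z, w e := by
  rw [bdry, Finsupp.linearCombination_apply, Finsupp.sum_of_support_subset _ hs _ (by simp),
    Finsupp.finsetSum_apply, Finset.sum_filter, Finset.sum_filter, ← Finset.sum_sub_distrib]
  refine Finset.sum_congr rfl fun e _ => ?_
  simp only [Finsupp.smul_apply, Finsupp.sub_apply, Finsupp.single_apply, smul_eq_mul, mul_sub,
    mul_ite, mul_one, mul_zero]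

theorem exists_mem_support_of_bdry_ne_zero {w : V × V →₀ ℝ} {z : V} (h : bdry w z ≠ 0) :
    ∃ e ∈ w.support, e.1 = z ∨ e.2 = z := by
  by_contra! hc
  apply h
  rw [bdry_apply subset_rfl, Finset.sum_eq_zero, Finset.sum_eq_zero, sub_zero]
  · intro e he
    exact absurd (Finset.mem_filter.1 he).2 (hc e (Finset.mem_filter.1 he).1).2
  · intro e he
    exact absurd (Finset.mem_filter.1 he).2 (hc e (Finset.mem_filter.1 he).1).1

theorem sum_bdry (w : V × V →₀ ℝ) : ((bdry w).sum fun _ t => t) = 0 := by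
  have := sum_bdry_mul (fun _ => (1 : ℝ)) w
  simpa using this

theorem bdry_mapDomain {V' : Type*} (f : V → V') (w : V × V →₀ ℝ) :
    bdry (w.mapDomain (Prod.map f f)) = (bdry w).mapDomain f := by
  induction w using Finsupp.induction_linear with
  | zero => simp
  | add g h hg hh => simp only [Finsupp.mapDomain_add, map_add, hg, hh]
  | single e t =>
    rw [Finsupp.mapDomain_single, bdry_single, bdry_single, ← Finsupp.lmapDomain_apply ℝ ℝ,
      map_sub]
    simp

/-- A weighted edge family is rigid if its support carries no nonzero circulation. -/
def RigidFlow (w : V × V →₀ ℝ) : Prop :=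
  ∀ θ : V × V →₀ ℝ, θ.support ⊆ w.support → bdry θ = 0 → θ = 0

theorem RigidFlow.mono {w w' : V × V →₀ ℝ} (h : RigidFlow w) (hs : w'.support ⊆ w.support) :
    RigidFlow w' := fun θ hθ h0 => h θ (hθ.trans hs) h0

theorem exists_nonneg_chain {w : V × V →₀ ℝ} {a b : V}
    (h : Relation.ReflTransGen (fun u v => (u, v) ∈ w.support) a b) :
    ∃ θ : V × V →₀ ℝ, (∀ e, 0 ≤ θ e) ∧ θ.support ⊆ w.support ∧
      bdry θ = Finsupp.single a 1 - Finsupp.single b 1 := by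
  induction h with
  | refl => exact ⟨0, by simp, by simp, by simp⟩
  | @tail b c _ hbc ih =>
    obtain ⟨θ, h0, hs, hb⟩ := ih
    refine ⟨θ + Finsupp.single (b, c) 1, fun e => ?_, ?_, ?_⟩
    · exact add_nonneg (h0 e) (by rw [Finsupp.single_apply]; split_ifs <;> simp)
    · refine Finsupp.support_add.trans (Finset.union_subset hs ?_)
      exact Finsupp.support_single_subset.trans (by simpa using hbc)
    · rw [map_add, hb, bdry_single]
      abel

/-- In a rigid flow every edge carries at most the total sink mass. -/
theorem RigidFlow.apply_le {w : V × V →₀ ℝ} (hr : RigidFlow w) (hw : ∀ e, 0 ≤ w e)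
    {μ ν : V →₀ ℝ} (hμ : ∀ z, 0 ≤ μ z) (hν : ∀ z, 0 ≤ ν z) (hb : bdry w = μ - ν) (e : V × V) :
    w e ≤ ν.sum fun _ t => t := by
  have hνs : 0 ≤ ν.sum fun _ t => t := Finset.sum_nonneg fun z _ => hν z
  by_cases he : e ∈ w.support
  swap
  · rwa [Finsupp.notMem_support_iff.1 he]
  let A : V → Prop := Relation.ReflTransGen (fun u v => (u, v) ∈ w.support) e.2
  have hA1 : ¬ A e.1 := by
    intro h
    obtain ⟨θ, h0, hs, hbθ⟩ := exists_nonneg_chain h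
    have := hr (θ + Finsupp.single e 1) (Finsupp.support_add.trans (Finset.union_subset hs
      (Finsupp.support_single_subset.trans (by simpa using he))))
      (by rw [map_add, hbθ, bdry_single]; abel)
    have h1 := DFunLike.congr_fun this e
    simp only [Finsupp.add_apply, Finsupp.single_eq_same, Finsupp.zero_apply] at h1
    linarith [h0 e]
  have hA2 : A e.2 := Relation.ReflTransGen.refl
  have key := linearCombination_bdry (fun z => if A z then (1 : ℝ) else 0) w
  rw [hb, map_sub, Finsupp.linearCombination_apply, Finsupp.linearCombination_apply,
    Finsupp.linearCombination_apply] at key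
  have h1 : 0 ≤ μ.sum fun z t => t • (if A z then (1 : ℝ) else 0) :=
    Finset.sum_nonneg fun z _ => mul_nonneg (hμ z) (by split_ifs <;> simp)
  have h2 : (ν.sum fun z t => t • (if A z then (1 : ℝ) else 0)) ≤ ν.sum fun _ t => t := by
    refine Finset.sum_le_sum fun z _ => ?_
    exact mul_le_of_le_one_right (hν z) (by split_ifs <;> simp)
  have h3 : (w.sum fun e t => t • ((if A e.1 then (1 : ℝ) else 0) - (if A e.2 then 1 else 0)))
      ≤ - w e := by
    unfold Finsupp.sum
    rw [← Finset.add_sum_erase _ _ he]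
    have : ∑ x ∈ w.support.erase e,
        w x • ((if A x.1 then (1 : ℝ) else 0) - (if A x.2 then 1 else 0)) ≤ 0 := by
      refine Finset.sum_nonpos fun x hx => mul_nonpos_of_nonneg_of_nonpos (hw x) ?_
      by_cases hx1 : A x.1
      · have : A x.2 := hx1.tail (Finset.mem_of_mem_erase hx)
        simp [hx1, this]
      · simp only [hx1, if_false]
        split_ifs <;> simp
    simp only [hA1, hA2, if_true, if_false, smul_eq_mul] at this ⊢
    linarith
  linarith

/-- The part of a nonnegative flow that feeds a prescribed part of its sink measure. -/
theorem exists_subflow {f : V × V →₀ ℝ} (hf : ∀ e, 0 ≤ f e) {μ ν ν' : V →₀ ℝ}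
    (hμ : ∀ z, 0 ≤ μ z) (hν' : ∀ z, 0 ≤ ν' z) (hνν' : ∀ z, ν' z ≤ ν z)
    (hb : bdry f = μ - ν) :
    ∃ (f' : V × V →₀ ℝ) (μ' : V →₀ ℝ), (∀ e, 0 ≤ f' e) ∧ (∀ e, f' e ≤ f e) ∧
      (∀ z, 0 ≤ μ' z) ∧ (∀ z, μ' z ≤ μ z) ∧ bdry f' = μ' - ν' := by
  set s := f.support
  have hout0 : ∀ z, 0 ≤ ∑ e ∈ s with e.1 = z, f e := fun z => Finset.sum_nonneg fun e _ => hf e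
  have hin0 : ∀ z, 0 ≤ ∑ e ∈ s with e.2 = z, f e := fun z => Finset.sum_nonneg fun e _ => hf e
  let thr : V → ℝ := fun z => ∑ e ∈ s with e.1 = z, f e + ν z
  have hν0 : ∀ z, 0 ≤ ν z := fun z => (hν' z).trans (hνν' z)
  have hthr0 : ∀ z, 0 ≤ thr z := fun z => add_nonneg (hout0 z) (hν0 z)
  have hthr : ∀ z, thr z = ∑ e ∈ s with e.2 = z, f e + μ z := by
    intro z
    have h1 := bdry_apply (w := f) (s := s) subset_rfl z
    have h2 := DFunLike.congr_fun hb z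
    rw [Finsupp.sub_apply] at h2
    simp only [thr]
    linarith
  let N : (V → Set.Icc (0 : ℝ) 1) → V → ℝ :=
    fun ρ z => ∑ e ∈ s with e.1 = z, f e * (ρ e.2 : ℝ) + ν' z
  have hN0 : ∀ ρ z, 0 ≤ N ρ z := fun ρ z =>
    add_nonneg (Finset.sum_nonneg fun e _ => mul_nonneg (hf e) (ρ e.2).2.1) (hν' z)
  have hN1 : ∀ ρ z, N ρ z ≤ thr z := fun ρ z =>
    add_le_add (Finset.sum_le_sum fun e _ => mul_le_of_le_one_right (hf e) (ρ e.2).2.2) (hνν' z)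
  let T : (V → Set.Icc (0 : ℝ) 1) →o (V → Set.Icc (0 : ℝ) 1) :=
    { toFun := fun ρ z => ⟨N ρ z / thr z, div_nonneg (hN0 ρ z) (hthr0 z),
        div_le_one_of_le₀ (hN1 ρ z) (hthr0 z)⟩
      monotone' := by
        intro ρ ρ' h z
        refine Subtype.mk_le_mk.2 (div_le_div_of_nonneg_right ?_ (hthr0 z))
        refine add_le_add (Finset.sum_le_sum fun e _ => ?_) le_rfl
        exact mul_le_mul_of_nonneg_left (h e.2) (hf e) }
  let ρ := OrderHom.lfp T
  have hρ : ∀ z, (ρ z : ℝ) * thr z = N ρ z := by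
    intro z
    have h1 : T ρ = ρ := OrderHom.map_lfp T
    have h2 : N ρ z / thr z = ρ z := congrArg Subtype.val (congrFun h1 z)
    rcases (hthr0 z).eq_or_lt with h | h
    · have := hN1 ρ z
      have := hN0 ρ z
      rw [← h] at *
      linarith
    · rw [← h2, div_mul_cancel₀ _ h.ne']
  let f' : V × V →₀ ℝ := Finsupp.onFinset s (fun e => f e * (ρ e.2 : ℝ)) (by
    intro e he
    exact Finsupp.mem_support_iff.2 (left_ne_zero_of_mul he))
  let μ' : V →₀ ℝ := Finsupp.onFinset μ.support (fun z => (ρ z : ℝ) * μ z) (by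
    intro e he
    exact Finsupp.mem_support_iff.2 (right_ne_zero_of_mul he))
  refine ⟨f', μ', fun e => mul_nonneg (hf e) (ρ e.2).2.1,
    fun e => mul_le_of_le_one_right (hf e) (ρ e.2).2.2,
    fun z => mul_nonneg (ρ z).2.1 (hμ z), fun z => mul_le_of_le_one_left (hμ z) (ρ z).2.2, ?_⟩
  ext z
  rw [bdry_apply (s := s) Finsupp.support_onFinset_subset z, Finsupp.sub_apply]
  have h1 : ∑ e ∈ s with e.1 = z, f' e = N ρ z - ν' z := by
    simp only [N, add_sub_cancel_right]
    rfl
  have h2 : ∑ e ∈ s with e.2 = z, f' e = ρ z * ∑ e ∈ s with e.2 = z, f e := by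
    rw [Finset.mul_sum]
    refine Finset.sum_congr rfl fun e he => ?_
    have : e.2 = z := (Finset.mem_filter.1 he).2
    rw [← this, mul_comm]
    rfl
  have h3 : μ' z = ρ z * μ z := rfl
  rw [h1, h2, h3, ← hρ z, hthr z]
  ring

end Flow

section FlowCost

variable {V : Type*} [PseudoMetricSpace V] {α : ℝ}

/-- The cost `Σ φ_α(w(e)) · length(e)` of a weighted family of directed edges. -/
def flowCost (α : ℝ) (w : V × V →₀ ℝ) : ℝ :=
  w.sum fun e t => phi α t * dist e.1 e.2

theorem flowCost_eq_sum {w : V × V →₀ ℝ} {s : Finset (V × V)} (hs : w.support ⊆ s) :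
    flowCost α w = ∑ e ∈ s, phi α (w e) * dist e.1 e.2 :=
  Finsupp.sum_of_support_subset _ hs _ (by simp)

theorem flowCost_nonneg {w : V × V →₀ ℝ} (hw : ∀ e, 0 ≤ w e) : 0 ≤ flowCost α w :=
  Finset.sum_nonneg fun e _ => mul_nonneg (phi_nonneg (hw e)) dist_nonneg

@[simp] theorem flowCost_zero : flowCost α (0 : V × V →₀ ℝ) = 0 := by simp [flowCost]

theorem flowCost_single (e : V × V) (t : ℝ) :
    flowCost α (Finsupp.single e t) = phi α t * dist e.1 e.2 :=
  Finsupp.sum_single_index (by simp)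

theorem single_nonneg {ι : Type*} {t : ℝ} (ht : 0 ≤ t) (e e' : ι) :
    0 ≤ Finsupp.single e t e' := by
  rw [Finsupp.single_apply]
  split_ifs
  · exact ht
  · exact le_rfl

theorem flowCost_add_le (hα : 0 ≤ α) (hα1 : α ≤ 1) {w w' : V × V →₀ ℝ} (hw : ∀ e, 0 ≤ w e)
    (hw' : ∀ e, 0 ≤ w' e) : flowCost α (w + w') ≤ flowCost α w + flowCost α w' := by
  rw [flowCost_eq_sum Finsupp.support_add, flowCost_eq_sum Finset.subset_union_left,
    flowCost_eq_sum (w := w') Finset.subset_union_right, ← Finset.sum_add_distrib]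
  refine Finset.sum_le_sum fun e _ => ?_
  rw [← add_mul]
  exact mul_le_mul_of_nonneg_right (phi_add_le hα hα1 (hw e) (hw' e)) dist_nonneg

theorem flowCost_sum_le {ι : Type*} (hα : 0 ≤ α) (hα1 : α ≤ 1) (s : Finset ι)
    (w : ι → V × V →₀ ℝ) (hw : ∀ i ∈ s, ∀ e, 0 ≤ w i e) :
    flowCost α (∑ i ∈ s, w i) ≤ ∑ i ∈ s, flowCost α (w i) := by
  induction s using Finset.induction_on with
  | empty => simp
  | insert a s ha ih =>
    rw [Finset.sum_insert ha, Finset.sum_insert ha]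
    refine (flowCost_add_le hα hα1 (hw a (Finset.mem_insert_self a s)) fun e => ?_).trans
      (add_le_add le_rfl (ih fun i hi => hw i (Finset.mem_insert_of_mem hi)))
    rw [Finsupp.finsetSum_apply]
    exact Finset.sum_nonneg fun i hi => hw i (Finset.mem_insert_of_mem hi) e

theorem mapDomain_nonneg {ι κ : Type*} (f : ι → κ) {w : ι →₀ ℝ} (hw : ∀ e, 0 ≤ w e) (e : κ) :
    0 ≤ w.mapDomain f e := by
  rw [Finsupp.mapDomain, Finsupp.sum, Finsupp.finsetSum_apply]
  exact Finset.sum_nonneg fun i _ => single_nonneg (hw i) _ _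

theorem flowCost_mapDomain_le {V' : Type*} [PseudoMetricSpace V'] (hα : 0 ≤ α) (hα1 : α ≤ 1)
    {w : V × V →₀ ℝ} (hw : ∀ e, 0 ≤ w e) {f : V → V'} (hf : ∀ a b, dist (f a) (f b) ≤ dist a b) :
    flowCost α (w.mapDomain (Prod.map f f)) ≤ flowCost α w := by
  rw [Finsupp.mapDomain, Finsupp.sum]
  refine (flowCost_sum_le hα hα1 _ _ fun i _ => single_nonneg (hw i) _).trans ?_
  refine Finset.sum_le_sum fun e _ => ?_
  rw [flowCost_single]
  exact mul_le_mul_of_nonneg_left (hf _ _) (phi_nonneg (hw e))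

theorem phi_add_mul_le (hα : 0 ≤ α) (hα1 : α ≤ 1) {w d : ℝ} (hw : 0 < w) (hd : 0 ≤ w + d) :
    phi α (w + d) ≤ phi α w + α * w ^ (α - 1) * d := by
  have h1 : -1 ≤ d / w := by rw [le_div_iff₀ hw]; linarith
  have h2 := rpow_one_add_le_one_add_mul_self h1 hα hα1
  have h3 : w + d = w * (1 + d / w) := by field_simp
  calc phi α (w + d) ≤ (w + d) ^ α := phi_le_rpow hd
    _ = w ^ α * (1 + d / w) ^ α := by rw [h3, Real.mul_rpow hw.le (by linarith)]
    _ ≤ w ^ α * (1 + α * (d / w)) := mul_le_mul_of_nonneg_left h2 (Real.rpow_nonneg hw.le α)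
    _ = _ := by rw [phi_of_ne hw.ne', Real.rpow_sub_one hw.ne']; ring

/-- A nonzero circulation carried by the support allows one to remove an edge without
increasing the cost. -/
theorem exists_support_ssubset (hα : 0 ≤ α) (hα1 : α ≤ 1) {w : V × V →₀ ℝ} (hw : ∀ e, 0 ≤ w e)
    (hr : ¬ RigidFlow w) :
    ∃ w' : V × V →₀ ℝ, (∀ e, 0 ≤ w' e) ∧ bdry w' = bdry w ∧ w'.support ⊂ w.support ∧
      flowCost α w' ≤ flowCost α w := by
  have hwpos : ∀ e ∈ w.support, 0 < w e := fun e he =>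
    (hw e).lt_of_ne' (Finsupp.mem_support_iff.1 he)
  let L : (V × V →₀ ℝ) → ℝ := fun θ =>
    ∑ e ∈ w.support, α * w e ^ (α - 1) * θ e * dist e.1 e.2
  have hLneg : ∀ θ, L (-θ) = - L θ := by
    intro θ
    simp [L, Finset.sum_neg_distrib]
  obtain ⟨θ, hs, hb, hL, e₁, he₁⟩ : ∃ θ : V × V →₀ ℝ, θ.support ⊆ w.support ∧ bdry θ = 0 ∧
      L θ ≤ 0 ∧ ∃ e, θ e < 0 := by
    unfold RigidFlow at hr
    push Not at hr
    obtain ⟨θ, hs, hb, h0⟩ := hr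
    have hneg : ∀ θ : V × V →₀ ℝ, L θ < 0 → ∃ e, θ e < 0 := by
      intro θ h
      by_contra! hc
      refine absurd h (not_lt.2 (Finset.sum_nonneg fun e _ => ?_))
      exact mul_nonneg (mul_nonneg (mul_nonneg hα (Real.rpow_nonneg (hw e) _)) (hc e)) dist_nonneg
    rcases lt_trichotomy (L θ) 0 with h | h | h
    · exact ⟨θ, hs, hb, h.le, hneg θ h⟩
    · obtain ⟨e, he⟩ := DFunLike.ne_iff.1 h0
      rcases lt_or_gt_of_ne he with h' | h'
      · exact ⟨θ, hs, hb, h.le, e, h'⟩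
      · exact ⟨-θ, by rwa [Finsupp.support_neg], by rw [map_neg, hb, neg_zero],
          by rw [hLneg, h, neg_zero], e, by simpa using h'⟩
    · have h' : L (-θ) < 0 := by rw [hLneg]; linarith
      exact ⟨-θ, by rwa [Finsupp.support_neg], by rw [map_neg, hb, neg_zero], h'.le, hneg _ h'⟩
  let N := w.support.filter fun e => θ e < 0
  have hN : N.Nonempty := ⟨e₁, Finset.mem_filter.2 ⟨hs (Finsupp.mem_support_iff.2 he₁.ne), he₁⟩⟩
  obtain ⟨e₀, he₀, hmin⟩ := Finset.exists_min_image N (fun e => w e / (-θ e)) hN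
  have hθ0 : θ e₀ < 0 := (Finset.mem_filter.1 he₀).2
  have hw0 := hwpos e₀ (Finset.mem_filter.1 he₀).1
  set t := w e₀ / (-θ e₀) with ht
  have ht0 : 0 < t := div_pos hw0 (by linarith)
  have happ : ∀ e, (w + t • θ) e = w e + t * θ e := fun e => by simp
  have hnn : ∀ e, 0 ≤ w e + t * θ e := by
    intro e
    by_cases h : θ e < 0
    · have he : e ∈ w.support := hs (Finsupp.mem_support_iff.2 h.ne)
      have := hmin e (Finset.mem_filter.2 ⟨he, h⟩)
      rw [le_div_iff₀ (by linarith)] at this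
      linarith
    · exact add_nonneg (hw e) (mul_nonneg ht0.le (not_lt.1 h))
  have hsub : (w + t • θ).support ⊆ w.support :=
    Finsupp.support_add.trans
      (Finset.union_subset subset_rfl (Finsupp.support_smul.trans hs))
  refine ⟨w + t • θ, fun e => by rw [happ]; exact hnn e, by rw [map_add, map_smul, hb]; simp,
    (Finset.ssubset_iff_of_subset hsub).2 ⟨e₀, (Finset.mem_filter.1 he₀).1, ?_⟩, ?_⟩
  · rw [Finsupp.notMem_support_iff, happ, ht, div_neg, neg_mul, div_mul_cancel₀ _ hθ0.ne,
      add_neg_cancel]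
  · rw [flowCost_eq_sum hsub, flowCost_eq_sum subset_rfl]
    have : ∑ e ∈ w.support, phi α ((w + t • θ) e) * dist e.1 e.2 ≤
        ∑ e ∈ w.support, phi α (w e) * dist e.1 e.2 + t * L θ := by
      rw [Finset.mul_sum, ← Finset.sum_add_distrib]
      refine Finset.sum_le_sum fun e he => ?_
      rw [happ]
      calc _ ≤ (phi α (w e) + α * w e ^ (α - 1) * (t * θ e)) * dist e.1 e.2 :=
            mul_le_mul_of_nonneg_right (phi_add_mul_le hα hα1 (hwpos e he) (hnn e)) dist_nonneg
        _ = _ := by ring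
    linarith [mul_nonpos_of_nonneg_of_nonpos ht0.le hL]

theorem exists_rigidFlow (hα : 0 ≤ α) (hα1 : α ≤ 1) (w : V × V →₀ ℝ) (hw : ∀ e, 0 ≤ w e) :
    ∃ w' : V × V →₀ ℝ, (∀ e, 0 ≤ w' e) ∧ bdry w' = bdry w ∧ w'.support ⊆ w.support ∧
      flowCost α w' ≤ flowCost α w ∧ RigidFlow w' := by
  induction hc : w.support.card using Nat.strong_induction_on generalizing w with
  | _ c ih =>
    by_cases hr : RigidFlow w
    · exact ⟨w, hw, rfl, subset_rfl, le_rfl, hr⟩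
    · obtain ⟨w₁, h0, hb, hs, hcost⟩ := exists_support_ssubset hα hα1 hw hr
      obtain ⟨w₂, h0', hb', hs', hcost', hr'⟩ :=
        ih _ (hc ▸ Finset.card_lt_card hs) w₁ h0 rfl
      exact ⟨w₂, h0', hb'.trans hb, hs'.trans hs.1, hcost'.trans hcost, hr'⟩

end FlowCost

section Subdivide

variable {m : ℕ} {α : ℝ}

/-- An edge lies on one side of the level set `h = σ`. -/
def OneSided {V : Type*} (h : V → ℝ) (σ : ℝ) (e : V × V) : Prop :=
  (h e.1 ≤ σ ∧ h e.2 ≤ σ) ∨ (σ ≤ h e.1 ∧ σ ≤ h e.2)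

theorem exists_mem_segment_oneSided (h : Pt m → ℝ) (hh : Continuous h) (σ : ℝ) (e : Pt m × Pt m) :
    ∃ c ∈ segment ℝ e.1 e.2, OneSided h σ (e.1, c) ∧ OneSided h σ (c, e.2) := by
  by_cases h1 : OneSided h σ e
  · refine ⟨e.1, left_mem_segment ℝ _ _, ?_, h1⟩
    rcases h1 with h1 | h1
    · exact Or.inl ⟨h1.1, h1.1⟩
    · exact Or.inr ⟨h1.1, h1.1⟩
  · have hconn : IsPreconnected (segment ℝ e.1 e.2) := (convex_segment e.1 e.2).isPreconnected
    have : ∃ c ∈ segment ℝ e.1 e.2, h c = σ := by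
      rcases le_total (h e.1) σ with h2 | h2
      · have h3 : σ ≤ h e.2 := by
          by_contra hc
          exact h1 (Or.inl ⟨h2, (not_le.1 hc).le⟩)
        exact hconn.intermediate_value (left_mem_segment ℝ _ _) (right_mem_segment ℝ _ _)
          hh.continuousOn ⟨h2, h3⟩
      · have h3 : h e.2 ≤ σ := by
          by_contra hc
          exact h1 (Or.inr ⟨h2, (not_le.1 hc).le⟩)
        exact hconn.intermediate_value (right_mem_segment ℝ _ _) (left_mem_segment ℝ _ _)
          hh.continuousOn ⟨h3, h2⟩
    obtain ⟨c, hc, rfl⟩ := this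
    refine ⟨c, hc, ?_, ?_⟩
    · rcases le_total (h e.1) (h c) with h | h
      · exact Or.inl ⟨h, le_rfl⟩
      · exact Or.inr ⟨h, le_rfl⟩
    · rcases le_total (h c) (h e.2) with h | h
      · exact Or.inr ⟨le_rfl, h⟩
      · exact Or.inl ⟨le_rfl, h⟩

theorem exists_oneSided_subdivision (hα : 0 ≤ α) (hα1 : α ≤ 1) (h : Pt m → ℝ) (hh : Continuous h)
    (σ : ℝ) (w : Pt m × Pt m →₀ ℝ) (hw : ∀ e, 0 ≤ w e) :
    ∃ w' : Pt m × Pt m →₀ ℝ, (∀ e, 0 ≤ w' e) ∧ bdry w' = bdry w ∧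
      flowCost α w' ≤ flowCost α w ∧ (∀ e ∈ w'.support, OneSided h σ e) ∧
      ∀ e ∈ w'.support, ∃ e₀ ∈ w.support,
        e.1 ∈ segment ℝ e₀.1 e₀.2 ∧ e.2 ∈ segment ℝ e₀.1 e₀.2 := by
  choose c hc hc1 hc2 using exists_mem_segment_oneSided h hh σ
  let g : Pt m × Pt m → (Pt m × Pt m →₀ ℝ) := fun e =>
    Finsupp.single (e.1, c e) (w e) + Finsupp.single (c e, e.2) (w e)
  have hg0 : ∀ e e', 0 ≤ g e e' := fun e e' =>
    add_nonneg (single_nonneg (hw e) _ _) (single_nonneg (hw e) _ _)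
  have hsupp : ∀ e ∈ (∑ e ∈ w.support, g e).support, ∃ e₀ ∈ w.support,
      e = (e₀.1, c e₀) ∨ e = (c e₀, e₀.2) := by
    intro e he
    rw [Finsupp.mem_support_iff, Finsupp.finsetSum_apply] at he
    obtain ⟨e₀, he₀, hne⟩ := Finset.exists_ne_zero_of_sum_ne_zero he
    refine ⟨e₀, he₀, ?_⟩
    by_contra! hcon
    apply hne
    simp only [g, Finsupp.add_apply, Finsupp.single_apply]
    rw [if_neg hcon.1.symm, if_neg hcon.2.symm, add_zero]
  refine ⟨∑ e ∈ w.support, g e, fun e => ?_, ?_, ?_, ?_, ?_⟩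
  · rw [Finsupp.finsetSum_apply]
    exact Finset.sum_nonneg fun i _ => hg0 i e
  · conv_rhs => rw [← Finsupp.sum_single w]
    rw [Finsupp.sum, map_sum, map_sum]
    refine Finset.sum_congr rfl fun e _ => ?_
    simp only [g]
    rw [map_add, bdry_single, bdry_single, bdry_single]
    abel
  · refine (flowCost_sum_le hα hα1 _ _ fun i _ => hg0 i).trans (Finset.sum_le_sum fun e _ => ?_)
    refine (flowCost_add_le hα hα1 (single_nonneg (hw e) _) (single_nonneg (hw e) _)).trans ?_
    rw [flowCost_single, flowCost_single, ← mul_add, dist_add_dist_of_mem_segment (hc e)]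
  · intro e he
    obtain ⟨e₀, -, rfl | rfl⟩ := hsupp e he
    · exact hc1 e₀
    · exact hc2 e₀
  · intro e he
    obtain ⟨e₀, h0, rfl | rfl⟩ := hsupp e he
    · exact ⟨e₀, h0, left_mem_segment ℝ _ _, hc e₀⟩
    · exact ⟨e₀, h0, hc e₀, right_mem_segment ℝ _ _⟩

end Subdivide

section TransportPath

variable {m : ℕ} {α : ℝ} {X : Set (Pt m)}

theorem exists_nonexpansive_retraction {K : Set (Pt m)} (hne : K.Nonempty) (hcl : IsClosed K)
    (hconv : Convex ℝ K) :
    ∃ P : Pt m → Pt m, (∀ z, P z ∈ K) ∧ (∀ z ∈ K, P z = z) ∧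
      ∀ a b, dist (P a) (P b) ≤ dist a b := by
  choose P hP hmin using exists_norm_eq_iInf_of_complete_convex hne hcl.isComplete hconv
  have hinner : ∀ u, ∀ w ∈ K, ⟪u - P u, w - P u⟫ ≤ 0 := fun u =>
    (norm_eq_iInf_iff_real_inner_le_zero hconv (hP u)).1 (hmin u)
  refine ⟨P, hP, fun z hz => ?_, fun a b => ?_⟩
  · have := hinner z z hz
    rw [real_inner_self_eq_norm_sq] at this
    have h0 : ‖z - P z‖ = 0 := by nlinarith [norm_nonneg (z - P z)]
    exact (sub_eq_zero.1 (norm_eq_zero.1 h0)).symm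
  · have h1 := hinner a (P b) (hP b)
    have h2 := hinner b (P a) (hP a)
    have h3 : ⟪P a - P b, P a - P b⟫ ≤ ⟪a - b, P a - P b⟫ := by
      have e1 : ⟪a - P a, P b - P a⟫ = - ⟪a - P a, P a - P b⟫ := by
        rw [← inner_neg_right, neg_sub]
      have e2 : ⟪a - b, P a - P b⟫ - ⟪P a - P b, P a - P b⟫ =
          ⟪a - P a, P a - P b⟫ - ⟪b - P b, P a - P b⟫ := by
        rw [← inner_sub_left, ← inner_sub_left]
        congr 1
        abel
      linarith
    have h4 := h3.trans (real_inner_le_norm _ _)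
    rw [real_inner_self_eq_norm_sq] at h4
    rw [dist_eq_norm, dist_eq_norm]
    by_contra! hc
    nlinarith [norm_nonneg (a - b), norm_nonneg (P a - P b)]

theorem exists_chain_of_walk {w : Pt m × Pt m →₀ ℝ} {H : SimpleGraph (Pt m)}
    (hH : ∀ a b, H.Adj a b → (a, b) ∈ w.support ∨ (b, a) ∈ w.support) {a b : Pt m}
    (q : H.Walk a b) :
    ∃ θ : Pt m × Pt m →₀ ℝ, θ.support ⊆ w.support ∧
      bdry θ = Finsupp.single a 1 - Finsupp.single b 1 ∧ ∀ e ∈ θ.support, H.Adj e.1 e.2 := by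
  induction q with
  | nil => exact ⟨0, by simp, by simp, by simp⟩
  | @cons a c b hac q ih =>
    obtain ⟨θ, hs, hb, hadj⟩ := ih
    have key : ∀ (e : Pt m × Pt m) (t : ℝ), e ∈ w.support → H.Adj e.1 e.2 →
        (θ + Finsupp.single e t).support ⊆ w.support ∧
          ∀ e' ∈ (θ + Finsupp.single e t).support, H.Adj e'.1 e'.2 := by
      intro e t he hadj'
      refine ⟨Finsupp.support_add.trans (Finset.union_subset hs
        (Finsupp.support_single_subset.trans (by simpa using he))), fun e' he' => ?_⟩
      rcases Finset.mem_union.1 (Finsupp.support_add he') with h | h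
      · exact hadj e' h
      · rw [Finset.mem_singleton.1 (Finsupp.support_single_subset h)]
        exact hadj'
    rcases hH a c hac with h | h
    · refine ⟨θ + Finsupp.single (a, c) 1, (key _ _ h hac).1, ?_, (key _ _ h hac).2⟩
      rw [map_add, hb, bdry_single]
      abel
    · refine ⟨θ + Finsupp.single (c, a) (-1), (key _ _ h hac.symm).1, ?_, (key _ _ h hac.symm).2⟩
      rw [map_add, hb, bdry_single, Finsupp.single_neg, Finsupp.single_neg]
      abel

theorem RigidFlow.isAcyclic {w : Pt m × Pt m →₀ ℝ} (hr : RigidFlow w) :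
    (SimpleGraph.fromRel fun u v => (u, v) ∈ w.support).IsAcyclic := by
  rw [SimpleGraph.isAcyclic_iff_forall_adj_isBridge]
  intro a b hab
  rw [SimpleGraph.isBridge_iff]
  rintro ⟨q⟩
  obtain ⟨θ, hs, hb, hadj⟩ := exists_chain_of_walk (w := w) (by
    intro u v huv
    exact (SimpleGraph.deleteEdges_le _ huv).2) q
  have hz : ∀ e : Pt m × Pt m, s(e.1, e.2) = s(a, b) → θ e = 0 := by
    intro e he
    by_contra hc
    have := hadj e (Finsupp.mem_support_iff.2 hc)
    rw [SimpleGraph.deleteEdges_adj] at this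
    exact this.2 he
  have key : ∀ (e : Pt m × Pt m) (t : ℝ), e ∈ w.support → s(e.1, e.2) = s(a, b) →
      bdry (θ + Finsupp.single e t) = 0 → t = 0 := by
    intro e t he hab h0
    have := DFunLike.congr_fun (hr _ (Finsupp.support_add.trans (Finset.union_subset hs
      (Finsupp.support_single_subset.trans (by simpa using he)))) h0) e
    simpa [hz e hab] using this
  rcases hab.2 with h | h
  · refine absurd (key (a, b) (-1) h rfl ?_) (by norm_num)
    rw [map_add, hb, bdry_single, Finsupp.single_neg, Finsupp.single_neg]
    abel
  · refine absurd (key (b, a) 1 h Sym2.eq_swap ?_) (by norm_num)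
    rw [map_add, hb, bdry_single]
    abel

theorem RigidFlow.exists_isTransportPath {w : Pt m × Pt m →₀ ℝ} (hr : RigidFlow w)
    (hw : ∀ e, 0 ≤ w e) (hX : ∀ e ∈ w.support, e.1 ∈ X ∧ e.2 ∈ X) {a b : Pt m →₀ ℝ}
    (ha : ↑a.support ⊆ X) (hb : ↑b.support ⊆ X) (hbd : bdry w = a - b) :
    ∃ G : WDG m, IsTransportPath X G a b ∧ WDG.cost α G = flowCost α w := by
  refine ⟨⟨w.support.image Prod.fst ∪ w.support.image Prod.snd ∪ (a.support ∪ b.support),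
    w.support, w⟩, ⟨?_, ?_, ?_, ?_, hr.isAcyclic, ?_⟩, ?_⟩
  · intro e he
    refine ⟨?_, ?_, ?_, (hw e).lt_of_ne' (Finsupp.mem_support_iff.1 he)⟩
    · exact Finset.mem_union_left _ (Finset.mem_union_left _ (Finset.mem_image_of_mem _ he))
    · exact Finset.mem_union_left _ (Finset.mem_union_right _ (Finset.mem_image_of_mem _ he))
    · intro h
      have := hr (Finsupp.single e 1) (Finsupp.support_single_subset.trans (by simpa using he))
        (by rw [bdry_single, h, sub_self])
      simp at this
  · intro z hz
    simp only [Finset.coe_union, Finset.coe_image] at hz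
    rcases hz with (⟨e, he, rfl⟩ | ⟨e, he, rfl⟩) | hz | hz
    · exact (hX e he).1
    · exact (hX e he).2
    · exact ha hz
    · exact hb hz
  · exact fun z hz => Finset.mem_union_right _ (Finset.mem_union_left _ hz)
  · exact fun z hz => Finset.mem_union_right _ (Finset.mem_union_right _ hz)
  · intro z
    have := bdry_apply (w := w) subset_rfl z
    rw [hbd, Finsupp.sub_apply] at this
    rw [this]
    unfold WDG.outflow WDG.inflow
    congr!
  · rw [flowCost_eq_sum subset_rfl]
    refine Finset.sum_congr rfl fun e he => ?_
    rw [phi_of_ne (Finsupp.mem_support_iff.1 he)]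

theorem IsTransportPath.exists_flow {G : WDG m} {a b : Pt m →₀ ℝ}
    (hG : IsTransportPath X G a b) :
    ∃ w : Pt m × Pt m →₀ ℝ, (∀ e, 0 ≤ w e) ∧ bdry w = a - b ∧
      flowCost α w = WDG.cost α G := by
  obtain ⟨hE, -, -, -, -, hbal⟩ := hG
  let w : Pt m × Pt m →₀ ℝ := Finsupp.onFinset G.E (fun e => if e ∈ G.E then G.w e else 0) (by
    intro e he
    by_contra hc
    exact he (if_neg hc))
  have hwE : ∀ e ∈ G.E, w e = G.w e := fun e he => if_pos he
  have hs : w.support ⊆ G.E := Finsupp.support_onFinset_subset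
  refine ⟨w, fun e => ?_, ?_, ?_⟩
  · by_cases he : e ∈ G.E
    · rw [hwE e he]
      exact (hE e he).2.2.2.le
    · exact (if_neg he).ge
  · ext z
    rw [bdry_apply hs, Finsupp.sub_apply, ← hbal z]
    congr 1
    · unfold WDG.outflow
      exact Finset.sum_congr (by congr!) fun e he => hwE e (Finset.mem_filter.1 he).1
    · unfold WDG.inflow
      exact Finset.sum_congr (by congr!) fun e he => hwE e (Finset.mem_filter.1 he).1
  · rw [flowCost_eq_sum hs]
    refine Finset.sum_congr rfl fun e he => ?_
    rw [hwE e he, phi_of_ne (hE e he).2.2.2.ne']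

theorem mapDomain_eq_self {f : Pt m → Pt m} {a : Pt m →₀ ℝ} (h : ∀ z ∈ a.support, f z = z) :
    a.mapDomain f = a := by
  rw [Finsupp.mapDomain_congr (g := id) h, Finsupp.mapDomain_id]

/-- Flows can be retracted to any closed convex set containing their sources and sinks. -/
theorem exists_flow_mem {K : Set (Pt m)} (hne : K.Nonempty) (hcl : IsClosed K)
    (hconv : Convex ℝ K) (hα : 0 ≤ α) (hα1 : α ≤ 1) {w : Pt m × Pt m →₀ ℝ} (hw : ∀ e, 0 ≤ w e)
    {a b : Pt m →₀ ℝ} (ha : ↑a.support ⊆ K) (hb : ↑b.support ⊆ K) (hbd : bdry w = a - b) :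
    ∃ w' : Pt m × Pt m →₀ ℝ, (∀ e, 0 ≤ w' e) ∧ bdry w' = a - b ∧
      flowCost α w' ≤ flowCost α w ∧ ∀ e ∈ w'.support, e.1 ∈ K ∧ e.2 ∈ K := by
  obtain ⟨P, hP, hfix, hlip⟩ := exists_nonexpansive_retraction hne hcl hconv
  refine ⟨w.mapDomain (Prod.map P P), mapDomain_nonneg _ hw, ?_, flowCost_mapDomain_le hα hα1 hw hlip,
    fun e he => ?_⟩
  · rw [bdry_mapDomain, hbd, ← Finsupp.lmapDomain_apply ℝ ℝ, map_sub, Finsupp.lmapDomain_apply,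
      Finsupp.lmapDomain_apply, mapDomain_eq_self fun z hz => hfix z (ha hz),
      mapDomain_eq_self fun z hz => hfix z (hb hz)]
  · obtain ⟨e', -, rfl⟩ := Finset.mem_image.1 (Finsupp.mapDomain_support he)
    exact ⟨hP _, hP _⟩

theorem exists_isTransportPath_of_flow (hne : X.Nonempty) (hcl : IsClosed X) (hconv : Convex ℝ X)
    (hα : 0 ≤ α) (hα1 : α ≤ 1) {w : Pt m × Pt m →₀ ℝ} (hw : ∀ e, 0 ≤ w e)
    {a b : Pt m →₀ ℝ} (ha : ↑a.support ⊆ X) (hb : ↑b.support ⊆ X) (hbd : bdry w = a - b) :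
    ∃ G : WDG m, IsTransportPath X G a b ∧ WDG.cost α G ≤ flowCost α w := by
  obtain ⟨w₁, h0, hbd₁, hc₁, hX₁⟩ := exists_flow_mem hne hcl hconv hα hα1 hw ha hb hbd
  obtain ⟨w₂, h0', hbd₂, hs₂, hc₂, hr⟩ := exists_rigidFlow hα hα1 w₁ h0
  obtain ⟨G, hG, hcost⟩ := hr.exists_isTransportPath (α := α) h0' (fun e he => hX₁ e (hs₂ he)) ha hb
    (hbd₂.trans hbd₁)
  exact ⟨G, hG, hcost.le.trans (hc₂.trans hc₁)⟩

theorem dCost_le_flowCost (hne : X.Nonempty) (hcl : IsClosed X) (hconv : Convex ℝ X)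
    (hα : 0 ≤ α) (hα1 : α ≤ 1) {w : Pt m × Pt m →₀ ℝ} (hw : ∀ e, 0 ≤ w e)
    {a b : Pt m →₀ ℝ} (ha : ↑a.support ⊆ X) (hb : ↑b.support ⊆ X) (hbd : bdry w = a - b) :
    dCost X α a b ≤ flowCost α w := by
  obtain ⟨G, hG, hcost⟩ := exists_isTransportPath_of_flow hne hcl hconv hα hα1 hw ha hb hbd
  refine le_trans (csInf_le ?_ ⟨G, hG, rfl⟩) hcost
  refine ⟨0, ?_⟩
  rintro _ ⟨G', hG', rfl⟩
  obtain ⟨w', h0, -, hc⟩ := IsTransportPath.exists_flow (α := α) hG'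
  rw [← hc]
  exact flowCost_nonneg h0

theorem le_dCost {a b : Pt m →₀ ℝ} {c : ℝ} (hex : ∃ G, IsTransportPath X G a b)
    (h : ∀ w : Pt m × Pt m →₀ ℝ, (∀ e, 0 ≤ w e) → bdry w = a - b → c ≤ flowCost α w) :
    c ≤ dCost X α a b := by
  obtain ⟨G, hG⟩ := hex
  refine le_csInf ⟨_, G, hG, rfl⟩ ?_
  rintro _ ⟨G', hG', rfl⟩
  obtain ⟨w', h0, hbd, hc⟩ := IsTransportPath.exists_flow (α := α) hG'
  rw [← hc]
  exact h w' h0 hbd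

theorem dCost_add_le (hne : X.Nonempty) (hcl : IsClosed X) (hconv : Convex ℝ X)
    (hα : 0 ≤ α) (hα1 : α ≤ 1) {a b a' b' : Pt m →₀ ℝ} (hex : ∃ G, IsTransportPath X G a b)
    (hex' : ∃ G, IsTransportPath X G a' b') (ha : ↑a.support ⊆ X) (hb : ↑b.support ⊆ X)
    (ha' : ↑a'.support ⊆ X) (hb' : ↑b'.support ⊆ X) :
    dCost X α (a + a') (b + b') ≤ dCost X α a b + dCost X α a' b' := by
  have hsub : ∀ {f g : Pt m →₀ ℝ}, ↑f.support ⊆ X → ↑g.support ⊆ X → ↑(f + g).support ⊆ X := by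
    intro f g hf hg z hz
    rcases Finset.mem_union.1 (Finsupp.support_add hz) with h | h
    · exact hf h
    · exact hg h
  rw [← sub_le_iff_le_add]
  refine le_dCost hex fun w hw hbd => ?_
  rw [sub_le_comm]
  refine le_dCost hex' fun w' hw' hbd' => ?_
  rw [sub_le_iff_le_add']
  refine (dCost_le_flowCost hne hcl hconv hα hα1 (w := w + w') (fun e => add_nonneg (hw e) (hw' e))
    (hsub ha ha') (hsub hb hb') ?_).trans (flowCost_add_le hα hα1 hw hw')
  rw [map_add, hbd, hbd']
  abel

end TransportPath

section Dyadic

theorem dist_le_sqrt_mul {d : ℕ} {u c : Pt d} {L : ℝ} (hL : 0 ≤ L) (h : ∀ k, |u k - c k| ≤ L) :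
    dist c u ≤ Real.sqrt d * L := by
  rw [dist_comm, EuclideanSpace.dist_eq]
  refine Real.sqrt_le_iff.2 ⟨by positivity, ?_⟩
  rw [mul_pow, Real.sq_sqrt (Nat.cast_nonneg d)]
  calc ∑ k, dist (u k) (c k) ^ 2 ≤ ∑ _k : Fin d, L ^ 2 := by
        refine Finset.sum_le_sum fun k _ => ?_
        rw [Real.dist_eq]
        exact pow_le_pow_left₀ (abs_nonneg _) (h k) 2
    _ = _ := by simp

/-- Dyadic transport from the centre of a cube to an atomic measure in the cube. -/
theorem exists_dyadic_flow {d : ℕ} {α r κ : ℝ} (hα : 0 ≤ α) (hα1 : α ≤ 1)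
    (hr : r = ((2 : ℝ) ^ d) ^ (1 - α) / 2) (hκ0 : 0 ≤ κ) (hκ : r * (Real.sqrt d + κ) = κ)
    (M : ℕ) (N : ℕ) :
    ∀ (μ : Pt d →₀ ℝ) (c : Pt d) (L : ℝ), 0 ≤ L → (∀ z, 0 ≤ μ z) → μ.support.card ≤ M →
      (∀ u ∈ μ.support, ∀ k, |u k - c k| ≤ L) →
      ∃ f : Pt d × Pt d →₀ ℝ, (∀ e, 0 ≤ f e) ∧
        bdry f = Finsupp.single c (μ.sum fun _ t => t) - μ ∧
        flowCost α f ≤ (κ + r ^ N * (Real.sqrt d * M)) * L * phi α (μ.sum fun _ t => t) := by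
  induction N with
  | zero =>
    intro μ c L hL hμ hM hcube
    have hW : ∀ u ∈ μ.support, μ u ≤ μ.sum fun _ t => t := fun u hu =>
      Finset.single_le_sum (fun z _ => hμ z) hu
    have hphi : 0 ≤ phi α (μ.sum fun _ t => t) :=
      phi_nonneg (Finset.sum_nonneg fun z _ => hμ z)
    refine ⟨∑ u ∈ μ.support, Finsupp.single (c, u) (μ u), fun e => ?_, ?_, ?_⟩
    · rw [Finsupp.finsetSum_apply]
      exact Finset.sum_nonneg fun u _ => single_nonneg (hμ u) _ _
    · rw [map_sum]
      simp only [bdry_single]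
      rw [Finset.sum_sub_distrib, ← Finsupp.single_finsetSum]
      congr 1
      exact Finsupp.sum_single μ
    · refine (flowCost_sum_le hα hα1 _ _ fun u _ => single_nonneg (hμ u) _).trans ?_
      calc ∑ u ∈ μ.support, flowCost α (Finsupp.single (c, u) (μ u))
          ≤ ∑ _u ∈ μ.support, phi α (μ.sum fun _ t => t) * (Real.sqrt d * L) := by
            refine Finset.sum_le_sum fun u hu => ?_
            rw [flowCost_single]
            exact mul_le_mul (phi_mono hα (hμ u) (hW u hu)) (dist_le_sqrt_mul hL (hcube u hu))
              dist_nonneg hphi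
        _ = μ.support.card * (phi α (μ.sum fun _ t => t) * (Real.sqrt d * L)) := by simp
        _ ≤ M * (phi α (μ.sum fun _ t => t) * (Real.sqrt d * L)) := by
            refine mul_le_mul_of_nonneg_right (by exact_mod_cast hM) (by positivity)
        _ = Real.sqrt d * M * L * phi α (μ.sum fun _ t => t) := by ring
        _ ≤ _ := by
            rw [pow_zero, one_mul]
            gcongr
            linarith
  | succ N ih =>
    intro μ c L hL hμ hM hcube
    let sg : Pt d → Fin d → Bool := fun u k => decide (c k ≤ u k)
    let cc : (Fin d → Bool) → Pt d := fun ε =>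
      WithLp.toLp 2 fun k => c k + (if ε k then L / 2 else - (L / 2))
    let ν : (Fin d → Bool) → Pt d →₀ ℝ := fun ε => μ.filter fun u => sg u = ε
    let W : (Fin d → Bool) → ℝ := fun ε => (ν ε).sum fun _ t => t
    have hν0 : ∀ ε z, 0 ≤ ν ε z := by
      intro ε z
      simp only [ν, Finsupp.filter_apply]
      split_ifs
      · exact hμ z
      · exact le_rfl
    have hW0 : ∀ ε, 0 ≤ W ε := fun ε => Finset.sum_nonneg fun z _ => hν0 ε z
    have hνsum : ∑ ε, ν ε = μ := by
      ext z
      rw [Finsupp.finsetSum_apply]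
      simp [ν, Finsupp.filter_apply]
    have hWsum : ∑ ε, W ε = μ.sum fun _ t => t := by
      conv_rhs => rw [← hνsum]
      exact Finsupp.sum_finsetSum_index (fun _ => rfl) (fun _ _ _ => rfl)
    have hchild : ∀ ε, ∃ f : Pt d × Pt d →₀ ℝ, (∀ e, 0 ≤ f e) ∧
        bdry f = Finsupp.single (cc ε) (W ε) - ν ε ∧
        flowCost α f ≤ (κ + r ^ N * (Real.sqrt d * M)) * (L / 2) * phi α (W ε) := by
      intro ε
      refine ih (ν ε) (cc ε) (L / 2) (by positivity) (hν0 ε) ?_ ?_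
      · refine (Finset.card_le_card ?_).trans hM
        rw [Finsupp.support_filter]
        exact Finset.filter_subset _ _
      · intro u hu k
        rw [Finsupp.support_filter, Finset.mem_filter] at hu
        have h1 := abs_le.1 (hcube u hu.1 k)
        have h2 : ε k = decide (c k ≤ u k) := (congrFun hu.2 k).symm
        simp only [cc, h2, decide_eq_true_eq]
        rw [abs_le]
        split_ifs with h
        · constructor <;> linarith
        · constructor <;> linarith
    choose f hf0 hfb hfc using hchild
    have hcd : ∀ ε, dist c (cc ε) ≤ Real.sqrt d * (L / 2) := by
      intro ε
      refine dist_le_sqrt_mul (by positivity) fun k => ?_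
      simp only [cc, add_sub_cancel_left]
      split_ifs
      · rw [abs_of_nonneg (by positivity)]
      · rw [abs_neg, abs_of_nonneg (by positivity)]
    have hg0 : ∀ ε e, 0 ≤ (f ε + Finsupp.single (c, cc ε) (W ε)) e := fun ε e =>
      add_nonneg (hf0 ε e) (single_nonneg (hW0 ε) _ _)
    refine ⟨∑ ε, (f ε + Finsupp.single (c, cc ε) (W ε)), fun e => ?_, ?_, ?_⟩
    · rw [Finsupp.finsetSum_apply]
      exact Finset.sum_nonneg fun ε _ => hg0 ε e
    · rw [map_sum]
      calc ∑ ε, bdry (f ε + Finsupp.single (c, cc ε) (W ε))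
          = ∑ ε, (Finsupp.single c (W ε) - ν ε) := by
            refine Finset.sum_congr rfl fun ε _ => ?_
            rw [map_add, hfb, bdry_single]
            abel
        _ = _ := by
            rw [Finset.sum_sub_distrib, hνsum, ← Finsupp.single_finsetSum, hWsum]
    · have hr0 : 0 ≤ r := by rw [hr]; positivity
      calc flowCost α (∑ ε, (f ε + Finsupp.single (c, cc ε) (W ε)))
          ≤ ∑ ε, flowCost α (f ε + Finsupp.single (c, cc ε) (W ε)) :=
            flowCost_sum_le hα hα1 _ _ fun ε _ => hg0 ε
        _ ≤ ∑ ε, ((κ + r ^ N * (Real.sqrt d * M)) * (L / 2) * phi α (W ε) +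
              phi α (W ε) * (Real.sqrt d * (L / 2))) := by
            refine Finset.sum_le_sum fun ε _ => ?_
            refine (flowCost_add_le hα hα1 (hf0 ε) (single_nonneg (hW0 ε) _)).trans ?_
            rw [flowCost_single]
            exact add_le_add (hfc ε) (mul_le_mul_of_nonneg_left (hcd ε) (phi_nonneg (hW0 ε)))
        _ = (κ + r ^ N * (Real.sqrt d * M) + Real.sqrt d) * (L / 2) * ∑ ε, phi α (W ε) := by
            rw [Finset.mul_sum]
            exact Finset.sum_congr rfl fun ε _ => by ring
        _ ≤ (κ + r ^ N * (Real.sqrt d * M) + Real.sqrt d) * (L / 2) *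
              (((2 : ℝ) ^ d) ^ (1 - α) * phi α (∑ ε, W ε)) := by
            refine mul_le_mul_of_nonneg_left ?_ (by positivity)
            have := sum_phi_le hα hα1 Finset.univ W fun ε _ => hW0 ε
            simpa using this
        _ = (r * (Real.sqrt d + κ) + r ^ (N + 1) * (Real.sqrt d * M)) * L *
              phi α (∑ ε, W ε) := by
            rw [hr]
            ring
        _ = _ := by rw [hκ, hWsum]

end Dyadic

section Slice

theorem norm_apply_le_norm {d : ℕ} (u : Pt d) (k : Fin d) : |u k| ≤ ‖u‖ := by
  rw [← Real.norm_eq_abs]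
  exact PiLp.norm_apply_le u k

/-- Every slice orthogonal to a unit vector is isometric to a Euclidean space. -/
theorem exists_slice_chart {d : ℕ} {p v : Pt (d + 1)} (hv : ‖v‖ = 1) (σ : ℝ) :
    ∃ (τ : Pt d → Pt (d + 1)) (τ' : Pt (d + 1) → Pt d), (∀ a b, dist (τ a) (τ b) ≤ dist a b) ∧
      τ 0 = p + σ • v ∧ ∀ z, proj p v z = σ →
        τ (τ' z) = z ∧ ‖τ' z‖ ≤ ‖z - p - proj p v z • v‖ := by
  have hv0 : v ≠ 0 := by
    rintro rfl
    simp at hv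
  have : Fact (Module.finrank ℝ (Pt (d + 1)) = d + 1) := ⟨by simp⟩
  let B := OrthonormalBasis.fromOrthogonalSpanSingleton (𝕜 := ℝ) d hv0
  let Q : Pt (d + 1) → (Submodule.span ℝ {v})ᗮ := fun z =>
    if h : z ∈ (Submodule.span ℝ {v})ᗮ then ⟨z, h⟩ else 0
  refine ⟨fun u => (B.repr.symm u : Pt (d + 1)) + (p + σ • v),
    fun z => B.repr (Q (z - p - σ • v)), fun a b => ?_, by simp, fun z hz => ?_⟩
  · rw [dist_add_right]
    exact (B.repr.symm.dist_map a b).le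
  · have hmem : z - p - σ • v ∈ (Submodule.span ℝ {v})ᗮ := by
      rw [Submodule.mem_orthogonal_singleton_iff_inner_left, inner_sub_left, inner_smul_left,
        real_inner_self_eq_norm_sq, hv]
      have : ⟪z - p, v⟫ = σ := hz
      rw [this]
      simp
    have hQ : Q (z - p - σ • v) = ⟨z - p - σ • v, hmem⟩ := dif_pos hmem
    refine ⟨?_, ?_⟩
    · beta_reduce
      rw [hQ, LinearIsometryEquiv.symm_apply_apply]
      simp
    · beta_reduce
      rw [hQ, LinearIsometryEquiv.norm_map, hz]
      exact le_rfl

theorem exists_slice_flow {m : ℕ} {α : ℝ} (hα : 0 ≤ α) (hα1 : α ≤ 1)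
    (hmα : ((m : ℝ) - 1) * (1 - α) < 1) {p v : Pt m} (hv : ‖v‖ = 1) {R : ℝ} (hR : 0 ≤ R) (σ : ℝ)
    {ν : Pt m →₀ ℝ} (hν : ∀ z, 0 ≤ ν z)
    (hs : ∀ z ∈ ν.support, proj p v z = σ ∧ ‖z - p - proj p v z • v‖ ≤ R) {ε : ℝ} (hε : 0 < ε) :
    ∃ f : Pt m × Pt m →₀ ℝ, (∀ e, 0 ≤ f e) ∧
      bdry f = Finsupp.single (p + σ • v) (ν.sum fun _ t => t) - ν ∧
      flowCost α f ≤ (Cconst m α - 1) * R * phi α (ν.sum fun _ t => t) + ε := by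
  obtain _ | d := m
  · rw [Subsingleton.elim v 0, norm_zero] at hv
    norm_num at hv
  obtain ⟨τ, τ', hτ, hτ0, hinv⟩ := exists_slice_chart (p := p) hv σ
  have hmα' : (d : ℝ) * (1 - α) < 1 := by simpa using hmα
  set s : ℝ := (2 : ℝ) ^ (1 - (d : ℝ) * (1 - α)) with hs_def
  have hs1 : 1 < s := Real.one_lt_rpow (by norm_num) (by linarith)
  have hr : s⁻¹ = ((2 : ℝ) ^ d) ^ (1 - α) / 2 := by
    rw [hs_def, ← Real.rpow_natCast, ← Real.rpow_mul (by norm_num), ← Real.rpow_neg (by norm_num),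
      neg_sub, Real.rpow_sub (by norm_num), Real.rpow_one]
  have hκ : s⁻¹ * (Real.sqrt d + Real.sqrt d / (s - 1)) = Real.sqrt d / (s - 1) := by
    have : s - 1 ≠ 0 := by linarith
    field_simp
    ring
  have hC : Cconst (d + 1) α - 1 = Real.sqrt d / (s - 1) := by
    simp [Cconst, hs_def]
  have hphi : 0 ≤ phi α (ν.sum fun _ t => t) :=
    phi_nonneg (Finset.sum_nonneg fun z _ => hν z)
  set M := ν.support.card
  set A := Real.sqrt d * M * R * phi α (ν.sum fun _ t => t)
  have hA : 0 ≤ A := by positivity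
  obtain ⟨N, hN⟩ := exists_pow_lt_of_lt_one (div_pos hε (show 0 < A + 1 by linarith))
    (inv_lt_one_of_one_lt₀ hs1)
  have hmass : (ν.mapDomain τ').sum (fun _ t => t) = ν.sum fun _ t => t :=
    Finsupp.sum_mapDomain_index (fun _ => rfl) (fun _ _ _ => rfl)
  have hback : (ν.mapDomain τ').mapDomain τ = ν := by
    rw [← Finsupp.mapDomain_comp]
    exact mapDomain_eq_self fun z hz => (hinv z (hs z hz).1).1
  obtain ⟨f, hf0, hfb, hfc⟩ := exists_dyadic_flow (d := d) hα hα1 hr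
    (div_nonneg (Real.sqrt_nonneg _) (by linarith)) hκ M N (ν.mapDomain τ') 0 R hR
    (mapDomain_nonneg _ hν)
    ((Finset.card_le_card Finsupp.mapDomain_support).trans Finset.card_image_le) (by
      intro u hu k
      obtain ⟨z, hz, rfl⟩ := Finset.mem_image.1 (Finsupp.mapDomain_support hu)
      have := norm_apply_le_norm (τ' z) k
      simpa using this.trans ((hinv z (hs z hz).1).2.trans (hs z hz).2))
  refine ⟨f.mapDomain (Prod.map τ τ), mapDomain_nonneg _ hf0, ?_, ?_⟩
  · rw [bdry_mapDomain, hfb, ← Finsupp.lmapDomain_apply ℝ ℝ, map_sub, Finsupp.lmapDomain_apply,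
      Finsupp.lmapDomain_apply, Finsupp.mapDomain_single, hback, hτ0, hmass]
  · refine (flowCost_mapDomain_le hα hα1 hf0 hτ).trans (hfc.trans ?_)
    rw [hmass, hC]
    have h1 : s⁻¹ ^ N * A ≤ ε := by
      have h2 : s⁻¹ ^ N * (A + 1) < ε := (lt_div_iff₀ (by linarith)).1 hN
      have h3 : 0 ≤ s⁻¹ ^ N := by positivity
      linarith
    calc _ = Real.sqrt d / (s - 1) * R * phi α (ν.sum fun _ t => t) + s⁻¹ ^ N * A := by ring
      _ ≤ _ := by linarith

end Slice

section Side

variable {m : ℕ} {α : ℝ} {p v : Pt m}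

/-- The closed solid cylinder of radius `R` around the line through `p` in direction `v`. -/
def cylinder (p v : Pt m) (R : ℝ) : Set (Pt m) := {z | ‖z - p - proj p v z • v‖ ≤ R}

theorem continuous_proj (p v : Pt m) : Continuous (proj p v) := by
  unfold proj
  fun_prop

theorem isClosed_cylinder (p v : Pt m) (R : ℝ) : IsClosed (cylinder p v R) := by
  have := continuous_proj p v
  exact isClosed_le (by fun_prop) continuous_const

theorem proj_combo {a b : Pt m} {s t : ℝ} (hst : s + t = 1) :
    proj p v (s • a + t • b) = s * proj p v a + t * proj p v b := by
  have : s • a + t • b - p = s • (a - p) + t • (b - p) := by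
    have h : p = s • p + t • p := by rw [← add_smul, hst, one_smul]
    nth_rewrite 1 [h]
    module
  simp only [proj]
  rw [this, inner_add_left, real_inner_smul_left, real_inner_smul_left]

theorem convex_cylinder (p v : Pt m) (R : ℝ) : Convex ℝ (cylinder p v R) := by
  intro a ha b hb s t hs ht hst
  simp only [cylinder, Set.mem_ofPred_eq] at ha hb ⊢
  have : s • a + t • b - p - proj p v (s • a + t • b) • v =
      s • (a - p - proj p v a • v) + t • (b - p - proj p v b • v) := by
    have h : p = s • p + t • p := by rw [← add_smul, hst, one_smul]
    rw [proj_combo hst]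
    nth_rewrite 1 [h]
    module
  rw [this]
  refine (norm_add_le _ _).trans ?_
  rw [norm_smul, norm_smul, Real.norm_of_nonneg hs, Real.norm_of_nonneg ht]
  calc s * ‖a - p - proj p v a • v‖ + t * ‖b - p - proj p v b • v‖ ≤ s * R + t * R := by gcongr
    _ = R := by rw [← add_mul, hst, one_mul]

theorem proj_neg (p v z : Pt m) : proj p (-v) z = - proj p v z := by
  rw [proj, inner_neg_right, proj]

theorem cylinder_neg (p v : Pt m) (R : ℝ) : cylinder p (-v) R = cylinder p v R := by
  ext z
  simp [cylinder, proj_neg]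

theorem abs_proj_sub_le (hv : ‖v‖ = 1) (p a b : Pt m) : |proj p v a - proj p v b| ≤ dist a b := by
  have : proj p v a - proj p v b = ⟪a - b, v⟫ := by
    rw [proj, proj, ← inner_sub_left]
    congr 1
    abel
  rw [this, dist_eq_norm]
  simpa [hv] using abs_real_inner_le_norm (a - b) v

theorem dist_axis_le (hv : ‖v‖ = 1) {R : ℝ} {z : Pt m} (hz : z ∈ cylinder p v R) (σ : ℝ) :
    dist z (p + σ • v) ≤ |proj p v z - σ| + R := by
  have : z - (p + σ • v) = (proj p v z - σ) • v + (z - p - proj p v z • v) := by module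
  rw [dist_eq_norm, this]
  refine (norm_add_le _ _).trans (add_le_add ?_ hz)
  rw [norm_smul, hv, mul_one, Real.norm_eq_abs]

/-- The length of the part of an edge beyond level `σ`, plus the variation of the projection
between the levels `t` and `σ`. -/
def sideLength (p v : Pt m) (t σ : ℝ) (e : Pt m × Pt m) : ℝ :=
  (if σ ≤ proj p v e.1 ∧ σ ≤ proj p v e.2 then dist e.1 e.2 else 0) +
    |max t (min σ (proj p v e.1)) - max t (min σ (proj p v e.2))|

theorem sum_sub_eq (a b : Pt m →₀ ℝ) :
    ((a - b).sum fun _ t => t) = (a.sum fun _ t => t) - b.sum fun _ t => t :=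
  Finsupp.sum_sub_index fun _ _ _ => rfl

theorem RigidFlow.phi_mul_le_sum {w : Pt m × Pt m →₀ ℝ} (hα1 : α ≤ 1) (hw : ∀ e, 0 ≤ w e)
    (hr : RigidFlow w) {x₀ : Pt m} {b : Pt m →₀ ℝ} (hb : ∀ z, 0 ≤ b z)
    (hbd : bdry w = Finsupp.single x₀ (b.sum fun _ t => t) - b) {h : Pt m → ℝ} {t σ : ℝ}
    (ht : h x₀ = t) (hσ : ∀ z ∈ b.support, h z = σ) :
    phi α (b.sum fun _ t => t) * (σ - t) ≤
      ∑ e ∈ w.support, phi α (w e) * |h e.1 - h e.2| := by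
  set W := b.sum fun _ t => t with hWdef
  have hW0 : 0 ≤ W := Finset.sum_nonneg fun z _ => hb z
  have hW : ∀ e, w e ≤ W := hr.apply_le hw (single_nonneg hW0 _) hb hbd
  have hpair := sum_bdry_mul h w
  have hl : ((bdry w).sum fun z s => s * h z) = W * t - W * σ := by
    rw [hbd, Finsupp.sum_sub_index (fun _ _ _ => sub_mul _ _ _),
      Finsupp.sum_single_index (zero_mul _), ht]
    congr 1
    calc (b.sum fun z s => s * h z) = b.sum fun z s => s * σ :=
          Finset.sum_congr rfl fun z hz => by simp only [hσ z hz]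
      _ = W * σ := by rw [hWdef, Finsupp.sum, Finsupp.sum, Finset.sum_mul]
  calc phi α W * (σ - t) = W ^ (α - 1) * - (W * t - W * σ) := by
        rw [phi_eq_rpow_sub_one_mul hW0]
        ring
    _ = ∑ e ∈ w.support, W ^ (α - 1) * w e * -(h e.1 - h e.2) := by
        rw [← hl, hpair, ← Finset.sum_neg_distrib, Finset.mul_sum]
        exact Finset.sum_congr rfl fun e _ => by ring
    _ ≤ _ := Finset.sum_le_sum fun e _ =>
        (mul_le_mul_of_nonneg_left (neg_le_abs _)
          (mul_nonneg (Real.rpow_nonneg hW0 _) (hw e))).trans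
        (mul_le_mul_of_nonneg_right (rpow_sub_one_mul_le_phi hα1 (hw e) (hW e)) (abs_nonneg _))

variable {X : Set (Pt m)}

theorem bdry_filter_apply {V : Type*} {w : V × V →₀ ℝ} {P : V × V → Prop}
    [DecidablePred P] {z : V}
    (h : ∀ e ∈ w.support, e.1 = z ∨ e.2 = z → P e) : bdry (w.filter P) z = bdry w z := by
  rw [bdry_apply (s := w.support) (by
    rw [Finsupp.support_filter]
    exact Finset.filter_subset _ _), bdry_apply subset_rfl]
  congr 1
  · exact Finset.sum_congr rfl fun e he => Finsupp.filter_apply_pos P w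
      (h e (Finset.mem_filter.1 he).1 (Or.inl (Finset.mem_filter.1 he).2))
  · exact Finset.sum_congr rfl fun e he => Finsupp.filter_apply_pos P w
      (h e (Finset.mem_filter.1 he).1 (Or.inr (Finset.mem_filter.1 he).2))

theorem sum_phi_mul_mono {V : Type*} (hα : 0 ≤ α) {w w' : V × V →₀ ℝ} (hw' : ∀ e, 0 ≤ w' e)
    (hle : ∀ e, w' e ≤ w e) (hs : w'.support ⊆ w.support) {g : V × V → ℝ} (hg : ∀ e, 0 ≤ g e) :
    ∑ e ∈ w'.support, phi α (w' e) * g e ≤ ∑ e ∈ w.support, phi α (w e) * g e :=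
  (Finset.sum_le_sum fun e _ =>
    mul_le_mul_of_nonneg_right (phi_mono hα (hw' e) (hle e)) (hg e)).trans
  (Finset.sum_le_sum_of_subset_of_nonneg hs fun e _ _ =>
    mul_nonneg (phi_nonneg ((hw' e).trans (hle e))) (hg e))

/-- A nonnegative flow can be cut at level `σ` of the projection: beyond this level there is a
flow feeding `b` from an atomic measure on the slice. -/
theorem exists_flow_beyond_level {w : Pt m × Pt m →₀ ℝ} (hw : ∀ e, 0 ≤ w e) {x₀ : Pt m} {W : ℝ}
    {b : Pt m →₀ ℝ} (hb : ∀ z, 0 ≤ b z) (hbd : bdry w = Finsupp.single x₀ W - b) {σ R : ℝ}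
    (hσ : proj p v x₀ < σ)
    (hcyl : ∀ e ∈ w.support, e.1 ∈ cylinder p v R ∧ e.2 ∈ cylinder p v R)
    (hside : ∀ e ∈ w.support, OneSided (proj p v) σ e)
    (hbc : ∀ z ∈ b.support, z ∈ cylinder p v R ∧ σ ≤ proj p v z) :
    ∃ (q : Pt m × Pt m →₀ ℝ) (μ : Pt m →₀ ℝ), (∀ e, 0 ≤ q e) ∧ (∀ e, q e ≤ w e) ∧
      (∀ e ∈ q.support, σ ≤ proj p v e.1 ∧ σ ≤ proj p v e.2) ∧ (∀ z, 0 ≤ μ z) ∧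
      (∀ z ∈ μ.support, proj p v z = σ ∧ z ∈ cylinder p v R) ∧ bdry q = μ - b := by
  let P : Pt m × Pt m → Prop := fun e => σ ≤ proj p v e.1 ∧ σ ≤ proj p v e.2
  let f := w.filter P
  have hfP : ∀ e, P e → f e = w e := fun e he => Finsupp.filter_apply_pos P w he
  have hfN : ∀ e, ¬ P e → f e = 0 := fun e he => Finsupp.filter_apply_neg P w he
  have hf0 : ∀ e, 0 ≤ f e := fun e => by
    by_cases he : P e
    · rw [hfP e he]
      exact hw e
    · rw [hfN e he]
  have hfw : ∀ e, f e ≤ w e := fun e => by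
    by_cases he : P e
    · rw [hfP e he]
    · rw [hfN e he]
      exact hw e
  have hfs : f.support ⊆ w.support := by
    rw [Finsupp.support_filter]
    exact Finset.filter_subset _ _
  let g := bdry f + b
  have hg : ∀ z, g z ≠ 0 → proj p v z = σ ∧ z ∈ cylinder p v R := by
    intro z hz
    have hinc : ∀ {u : Pt m × Pt m →₀ ℝ}, bdry u z ≠ 0 → u.support ⊆ w.support →
        z ∈ cylinder p v R := by
      intro u hu hs
      obtain ⟨e, he, rfl | rfl⟩ := exists_mem_support_of_bdry_ne_zero hu
      · exact (hcyl e (hs he)).1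
      · exact (hcyl e (hs he)).2
    refine ⟨?_, ?_⟩
    · rcases lt_trichotomy (proj p v z) σ with h | h | h
      · refine absurd ?_ hz
        have h1 : b z = 0 := by
          by_contra hc
          exact absurd (hbc z (Finsupp.mem_support_iff.2 hc)).2 (not_le.2 h)
        have h2 : bdry f z = 0 := by
          by_contra hc
          obtain ⟨e, he, h'⟩ := exists_mem_support_of_bdry_ne_zero hc
          refine Finsupp.mem_support_iff.1 he (hfN e fun hP => ?_)
          rcases h' with rfl | rfl
          · exact absurd hP.1 (not_le.2 h)
          · exact absurd hP.2 (not_le.2 h)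
        rw [Finsupp.add_apply, h1, h2, add_zero]
      · exact h
      · refine absurd ?_ hz
        have h1 : bdry f z = bdry w z := by
          have hPe : ∀ e ∈ w.support, e.1 = z ∨ e.2 = z → P e := by
            intro e he h'
            rcases hside e he with hs | hs
            · rcases h' with rfl | rfl
              · exact absurd hs.1 (not_le.2 h)
              · exact absurd hs.2 (not_le.2 h)
            · exact hs
          exact bdry_filter_apply hPe
        have h2 : z ≠ x₀ := by
          rintro rfl
          exact absurd hσ h.not_gt
        rw [Finsupp.add_apply, h1, hbd, Finsupp.sub_apply, Finsupp.single_eq_of_ne h2]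
        ring
    · by_cases h1 : b z = 0
      · have : bdry f z ≠ 0 := by
          intro h2
          exact hz (by rw [Finsupp.add_apply, h1, h2, add_zero])
        exact hinc this hfs
      · exact (hbc z (Finsupp.mem_support_iff.2 h1)).1
  let gp : Pt m →₀ ℝ := g.mapRange (fun t => max t 0) (by simp)
  let gm : Pt m →₀ ℝ := g.mapRange (fun t => max (-t) 0) (by simp)
  have hgp : ∀ z, gp z = max (g z) 0 := fun z => Finsupp.mapRange_apply ..
  have hgm : ∀ z, gm z = max (-g z) 0 := fun z => Finsupp.mapRange_apply ..
  have hfb : bdry f = gp - (b + gm) := by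
    ext z
    have h1 : g z = bdry f z + b z := rfl
    rw [Finsupp.sub_apply, Finsupp.add_apply, hgp, hgm]
    rcases le_total (g z) 0 with h | h
    · rw [max_eq_right h, max_eq_left (by linarith)]
      linarith
    · rw [max_eq_left h, max_eq_right (by linarith)]
      linarith
  obtain ⟨q, μ, hq0, hqf, hμ0, hμg, hqb⟩ := exists_subflow hf0 (μ := gp) (ν := b + gm) (ν' := b)
    (fun z => by rw [hgp]; exact le_max_right _ _) hb
    (fun z => by
      rw [Finsupp.add_apply, hgm]
      exact le_add_of_nonneg_right (le_max_right _ _)) hfb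
  refine ⟨q, μ, hq0, fun e => (hqf e).trans (hfw e), fun e he => ?_, hμ0, fun z hz => hg z ?_, hqb⟩
  · by_contra hc
    have h1 := hqf e
    rw [hfN e hc] at h1
    exact Finsupp.mem_support_iff.1 he (le_antisymm h1 (hq0 e))
  · intro h
    have h1 := hμg z
    rw [hgp, h, max_self] at h1
    exact Finsupp.mem_support_iff.1 hz (le_antisymm h1 (hμ0 z))

theorem dCost_add_le_sum_sideLength (hXc : IsClosed X) (hXconv : Convex ℝ X) (hα : 0 ≤ α)
    (hα1 : α ≤ 1) (hmα : ((m : ℝ) - 1) * (1 - α) < 1) (hv : ‖v‖ = 1) {R : ℝ} (hR : 0 ≤ R)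
    {w : Pt m × Pt m →₀ ℝ} (hw : ∀ e, 0 ≤ w e) (hr : RigidFlow w) {x₀ x₁ : Pt m} {M : ℝ}
    (hM : 0 ≤ M) {b b' : Pt m →₀ ℝ} (hb' : ∀ z, 0 ≤ b' z) (hbb' : ∀ z, b' z ≤ b z)
    (hbd : bdry w = Finsupp.single x₀ M - b) {σ : ℝ} (hσ : proj p v x₀ < σ)
    (hcyl : ∀ e ∈ w.support, e.1 ∈ cylinder p v R ∧ e.2 ∈ cylinder p v R)
    (hside : ∀ e ∈ w.support, OneSided (proj p v) σ e) (hx₁X : x₁ ∈ X)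
    (hx₁ : x₁ ∈ cylinder p v R)
    (hb'X : ∀ z ∈ b'.support, z ∈ X ∧ z ∈ cylinder p v R ∧ σ ≤ proj p v z) :
    dCost X α (Finsupp.single x₁ (b'.sum fun _ t => t)) b' +
        phi α (b'.sum fun _ t => t) *
          (σ - proj p v x₀ - |proj p v x₁ - σ| - Cconst m α * R) ≤
      ∑ e ∈ w.support, phi α (w e) * sideLength p v (proj p v x₀) σ e := by
  set W := b'.sum fun _ t => t with hWdef
  have hW0 : 0 ≤ W := Finset.sum_nonneg fun z _ => hb' z
  obtain ⟨w', μ', hw', hle, hμ0, hμle, hbd'⟩ :=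
    exists_subflow hw (single_nonneg hM x₀) hb' hbb' hbd
  have hs' : w'.support ⊆ w.support := by
    intro e he
    rw [Finsupp.mem_support_iff] at he ⊢
    intro h
    exact he (le_antisymm (h ▸ hle e) (hw' e))
  have hμ' : μ' = Finsupp.single x₀ W := by
    have h1 : μ' = Finsupp.single x₀ (μ' x₀) := by
      ext z
      by_cases hz : z = x₀
      · rw [hz, Finsupp.single_eq_same]
      · have := hμle z
        rw [Finsupp.single_eq_of_ne hz] at this ⊢
        exact le_antisymm this (hμ0 z)
    have h2 := sum_bdry w'
    rw [hbd', sum_sub_eq, h1, Finsupp.sum_single_index rfl] at h2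
    rw [h1, sub_eq_zero.1 h2]
  rw [hμ'] at hbd'
  have hA := (hr.mono hs').phi_mul_le_sum (α := α) hα1 hw' hb' hbd'
    (h := fun z => max (proj p v x₀) (min σ (proj p v z))) (t := proj p v x₀) (σ := σ)
    (by rw [min_eq_right hσ.le, max_self])
    (fun z hz => by rw [min_eq_left (hb'X z hz).2.2, max_eq_right hσ.le])
  replace hA := hA.trans (sum_phi_mul_mono hα hw' hle hs' fun e => abs_nonneg _)
  obtain ⟨q, μ, hq0, hqw, hqP, hμ0', hμs, hqb⟩ := exists_flow_beyond_level hw' hb' hbd' hσ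
    (fun e he => hcyl e (hs' he)) (fun e he => hside e (hs' he)) (fun z hz => (hb'X z hz).2)
  have hμW : (μ.sum fun _ t => t) = W := by
    have h2 := sum_bdry q
    rw [hqb, sum_sub_eq] at h2
    exact sub_eq_zero.1 h2
  have hqcost : flowCost α q ≤ ∑ e ∈ w.support, phi α (w e) *
      (if σ ≤ proj p v e.1 ∧ σ ≤ proj p v e.2 then dist e.1 e.2 else 0) := by
    refine le_trans (le_of_eq ?_) (sum_phi_mul_mono hα hq0 (fun e => (hqw e).trans (hle e)) ?_ ?_)
    · rw [flowCost_eq_sum subset_rfl]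
      exact Finset.sum_congr rfl fun e he => by rw [if_pos (hqP e he)]
    · intro e he
      rw [Finsupp.mem_support_iff] at he ⊢
      intro h
      exact he (le_antisymm (h ▸ (hqw e).trans (hle e)) (hq0 e))
    · intro e
      split_ifs
      · exact dist_nonneg
      · exact le_rfl
  have hd : dCost X α (Finsupp.single x₁ W) b' ≤ flowCost α q + (Cconst m α - 1) * R * phi α W +
      phi α W * (|proj p v x₁ - σ| + R) := by
    refine le_of_forall_pos_le_add fun ε hε => ?_
    obtain ⟨f, hf0, hfb, hfc⟩ := exists_slice_flow hα hα1 hmα hv hR σ hμ0' hμs hε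
    rw [hμW] at hfb hfc
    have hs0 : ∀ e, 0 ≤ Finsupp.single (x₁, p + σ • v) W e := single_nonneg hW0 _
    refine (dCost_le_flowCost (w := q + (f + Finsupp.single (x₁, p + σ • v) W)) ⟨x₁, hx₁X⟩ hXc hXconv
      hα hα1 (fun e => add_nonneg (hq0 e) (add_nonneg (hf0 e) (hs0 e))) ?_
      (fun z hz => (hb'X z hz).1) ?_).trans ?_
    · intro z hz
      rw [Finset.mem_singleton.1 (Finsupp.support_single_subset hz)]
      exact hx₁X
    · rw [map_add, map_add, hqb, hfb, bdry_single]
      abel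
    · have h1 := flowCost_add_le (w' := f + Finsupp.single (x₁, p + σ • v) W) hα hα1 hq0
        fun e => add_nonneg (hf0 e) (hs0 e)
      have h2 := flowCost_add_le hα hα1 hf0 hs0
      rw [flowCost_single] at h2
      have h3 := mul_le_mul_of_nonneg_left (dist_axis_le hv hx₁ σ) (phi_nonneg (α := α) hW0)
      refine h1.trans ?_
      linarith
  simp only [sideLength, mul_add, Finset.sum_add_distrib]
  linarith

theorem sideLength_add_sideLength_le (hv : ‖v‖ = 1) {t σ σ' : ℝ} (hσ : t < σ) (hσ' : -t < σ')
    {e : Pt m × Pt m} (he : OneSided (proj p v) σ e) (he' : OneSided (proj p (-v)) σ' e) :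
    sideLength p v t σ e + sideLength p (-v) (-t) σ' e ≤ dist e.1 e.2 := by
  have hd := abs_proj_sub_le hv p e.1 e.2
  have hd0 : 0 ≤ dist e.1 e.2 := dist_nonneg
  simp only [OneSided, sideLength, proj_neg] at he he' ⊢
  generalize proj p v e.1 = a at he he' hd ⊢
  generalize proj p v e.2 = c at he he' hd ⊢
  by_cases hP : σ ≤ a ∧ σ ≤ c
  · rw [if_pos hP, if_neg (by rintro ⟨h, -⟩; linarith [hP.1]), min_eq_left hP.1, min_eq_left hP.2,
      min_eq_right (by linarith [hP.1] : -a ≤ σ'), min_eq_right (by linarith [hP.2] : -c ≤ σ'),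
      max_eq_left (by linarith [hP.1] : -a ≤ -t), max_eq_left (by linarith [hP.2] : -c ≤ -t)]
    simp
  by_cases hP' : σ' ≤ -a ∧ σ' ≤ -c
  · rw [if_pos hP', if_neg hP, min_eq_left hP'.1, min_eq_left hP'.2,
      min_eq_right (by linarith [hP'.1] : a ≤ σ), min_eq_right (by linarith [hP'.2] : c ≤ σ),
      max_eq_left (by linarith [hP'.1] : a ≤ t), max_eq_left (by linarith [hP'.2] : c ≤ t)]
    simp
  have h1 := he.resolve_right hP
  have h2 := he'.resolve_right hP'
  rw [if_neg hP, if_neg hP', min_eq_right h1.1, min_eq_right h1.2, min_eq_right h2.1,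
    min_eq_right h2.2, max_neg_neg, max_neg_neg]
  refine le_trans (le_of_eq ?_) hd
  grind

theorem OneSided.of_mem_segment {σ : ℝ} {e e' : Pt m × Pt m} (h : OneSided (proj p v) σ e)
    (h1 : e'.1 ∈ segment ℝ e.1 e.2) (h2 : e'.2 ∈ segment ℝ e.1 e.2) :
    OneSided (proj p v) σ e' := by
  obtain ⟨s, t, hs, ht, hst, h1⟩ := h1
  obtain ⟨s', t', hs', ht', hst', h2⟩ := h2
  rw [OneSided, ← h1, ← h2, proj_combo hst, proj_combo hst']
  have e1 : σ = s * σ + t * σ := by rw [← add_mul, hst, one_mul]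
  have e2 : σ = s' * σ + t' * σ := by rw [← add_mul, hst', one_mul]
  rcases h with ⟨ha, hb⟩ | ⟨ha, hb⟩
  · left
    constructor
    · rw [e1]
      exact add_le_add (mul_le_mul_of_nonneg_left ha hs) (mul_le_mul_of_nonneg_left hb ht)
    · rw [e2]
      exact add_le_add (mul_le_mul_of_nonneg_left ha hs') (mul_le_mul_of_nonneg_left hb ht')
  · right
    constructor
    · rw [e1]
      exact add_le_add (mul_le_mul_of_nonneg_left ha hs) (mul_le_mul_of_nonneg_left hb ht)
    · rw [e2]
      exact add_le_add (mul_le_mul_of_nonneg_left ha hs') (mul_le_mul_of_nonneg_left hb ht')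

end Side

section Assign

variable {m k ℓ : ℕ} {α : ℝ} {p v : Pt m} {X : Set (Pt m)} {y : Fin ℓ → Pt m} {n : Fin ℓ → ℝ}

/-- The part of the household measure carried by a set of households. -/
def sinkOn (y : Fin ℓ → Pt m) (n : Fin ℓ → ℝ) (A : Finset (Fin ℓ)) : Pt m →₀ ℝ :=
  ∑ j ∈ A, Finsupp.single (y j) (n j)

/-- The optimal cost of supplying a set of households from a single location. -/
def supplyCost (X : Set (Pt m)) (α : ℝ) (y : Fin ℓ → Pt m) (n : Fin ℓ → ℝ) (a : Pt m)
    (A : Finset (Fin ℓ)) : ℝ :=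
  dCost X α (Finsupp.single a (∑ j ∈ A, n j)) (sinkOn y n A)

theorem sinkOn_apply (A : Finset (Fin ℓ)) (z : Pt m) :
    sinkOn y n A z = ∑ j ∈ A, Finsupp.single (y j) (n j) z :=
  Finsupp.finsetSum_apply _ _ _

theorem sinkOn_nonneg (hn : ∀ j, 0 ≤ n j) (A : Finset (Fin ℓ)) (z : Pt m) :
    0 ≤ sinkOn y n A z := by
  rw [sinkOn_apply]
  exact Finset.sum_nonneg fun j _ => single_nonneg (hn j) _ _

theorem sinkOn_mono (hn : ∀ j, 0 ≤ n j) {A B : Finset (Fin ℓ)} (h : A ⊆ B) (z : Pt m) :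
    sinkOn y n A z ≤ sinkOn y n B z := by
  rw [sinkOn_apply, sinkOn_apply]
  exact Finset.sum_le_sum_of_subset_of_nonneg h fun j _ _ => single_nonneg (hn j) _ _

theorem exists_of_mem_support_sinkOn {A : Finset (Fin ℓ)} {z : Pt m}
    (hz : z ∈ (sinkOn y n A).support) : ∃ j ∈ A, y j = z := by
  rw [Finsupp.mem_support_iff, sinkOn_apply] at hz
  obtain ⟨j, hj, hne⟩ := Finset.exists_ne_zero_of_sum_ne_zero hz
  refine ⟨j, hj, ?_⟩
  by_contra hc
  exact hne (Finsupp.single_eq_of_ne (Ne.symm hc))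

theorem sum_sinkOn (A : Finset (Fin ℓ)) : ((sinkOn y n A).sum fun _ t => t) = ∑ j ∈ A, n j := by
  rw [sinkOn, ← Finsupp.sum_finsetSum_index (fun _ => rfl) (fun _ _ _ => rfl)]
  exact Finset.sum_congr rfl fun j _ => Finsupp.sum_single_index rfl

theorem support_sinkOn_subset (hy : ∀ j, y j ∈ X) (A : Finset (Fin ℓ)) :
    ↑(sinkOn y n A).support ⊆ X := by
  intro z hz
  obtain ⟨j, -, rfl⟩ := exists_of_mem_support_sinkOn hz
  exact hy j

theorem support_single_subset {a : Pt m} (ha : a ∈ X) (t : ℝ) :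
    ↑(Finsupp.single a t).support ⊆ X := by
  intro z hz
  rw [Finset.mem_singleton.1 (Finsupp.support_single_subset hz)]
  exact ha

theorem exists_isTransportPath_sinkOn (hcl : IsClosed X) (hconv : Convex ℝ X)
    (hn : ∀ j, 0 ≤ n j) (hy : ∀ j, y j ∈ X) {a : Pt m} (ha : a ∈ X) (A : Finset (Fin ℓ)) :
    ∃ G, IsTransportPath X G (Finsupp.single a (∑ j ∈ A, n j)) (sinkOn y n A) := by
  obtain ⟨G, hG, -⟩ := exists_isTransportPath_of_flow (α := 0) ⟨a, ha⟩ hcl hconv le_rfl zero_le_one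
    (w := ∑ j ∈ A, Finsupp.single (a, y j) (n j)) (a := Finsupp.single a (∑ j ∈ A, n j))
    (b := sinkOn y n A) (fun e => by
      rw [Finsupp.finsetSum_apply]
      exact Finset.sum_nonneg fun j _ => single_nonneg (hn j) _ _)
    (support_single_subset ha _) (support_sinkOn_subset hy A) (by
      rw [map_sum, sinkOn, Finsupp.single_finsetSum, ← Finset.sum_sub_distrib]
      exact Finset.sum_congr rfl fun j _ => bdry_single _ _)
  exact ⟨G, hG⟩

theorem supplyCost_empty_le (hcl : IsClosed X) (hconv : Convex ℝ X) (hα : 0 ≤ α) (hα1 : α ≤ 1)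
    {a : Pt m} (ha : a ∈ X) : supplyCost X α y n a ∅ ≤ 0 := by
  refine (dCost_le_flowCost (w := 0) ⟨a, ha⟩ hcl hconv hα hα1 (fun _ => le_rfl)
    (support_single_subset ha _) ?_ ?_).trans_eq flowCost_zero <;> simp [sinkOn]

theorem supplyCost_union_le (hcl : IsClosed X) (hconv : Convex ℝ X) (hα : 0 ≤ α) (hα1 : α ≤ 1)
    (hn : ∀ j, 0 ≤ n j) (hy : ∀ j, y j ∈ X) {a : Pt m} (ha : a ∈ X) {A B : Finset (Fin ℓ)}
    (hAB : Disjoint A B) :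
    supplyCost X α y n a (A ∪ B) ≤ supplyCost X α y n a A + supplyCost X α y n a B := by
  have h := dCost_add_le ⟨a, ha⟩ hcl hconv hα hα1
    (exists_isTransportPath_sinkOn hcl hconv hn hy ha A)
    (exists_isTransportPath_sinkOn hcl hconv hn hy ha B) (support_single_subset ha _)
    (support_sinkOn_subset hy A) (support_single_subset ha _) (support_sinkOn_subset hy B)
  unfold supplyCost
  rw [Finset.sum_union hAB, Finsupp.single_add]
  convert h using 2
  exact Finset.sum_union hAB

/-- Supplying households on both sides of a factory costs more than supplying them from two other
locations, up to the displacement of these locations. -/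
theorem supplyCost_add_le (hcl : IsClosed X) (hconv : Convex ℝ X) (hα : 0 ≤ α) (hα1 : α ≤ 1)
    (hmα : ((m : ℝ) - 1) * (1 - α) < 1) (hv : ‖v‖ = 1) {R : ℝ} (hR : 0 ≤ R)
    (hn : ∀ j, 0 ≤ n j) (hy : ∀ j, y j ∈ X) (hyc : ∀ j, y j ∈ cylinder p v R)
    {x₀ x₁ x₂ : Pt m} (hx₀ : x₀ ∈ X) (hx₁ : x₁ ∈ X) (hx₂ : x₂ ∈ X)
    (hx₀c : x₀ ∈ cylinder p v R) (hx₁c : x₁ ∈ cylinder p v R) (hx₂c : x₂ ∈ cylinder p v R)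
    {σ₁ σ₂ : ℝ} (hσ₁ : proj p v x₀ < σ₁) (hσ₂ : proj p (-v) x₀ < σ₂) {J A₁ A₂ : Finset (Fin ℓ)}
    (hA₁ : A₁ ⊆ J) (hA₂ : A₂ ⊆ J) (hy₁ : ∀ j ∈ A₁, σ₁ ≤ proj p v (y j))
    (hy₂ : ∀ j ∈ A₂, σ₂ ≤ proj p (-v) (y j)) :
    (supplyCost X α y n x₁ A₁ + phi α (∑ j ∈ A₁, n j) *
        (σ₁ - proj p v x₀ - |proj p v x₁ - σ₁| - Cconst m α * R)) +
      (supplyCost X α y n x₂ A₂ + phi α (∑ j ∈ A₂, n j) *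
        (σ₂ - proj p (-v) x₀ - |proj p (-v) x₂ - σ₂| - Cconst m α * R)) ≤
      supplyCost X α y n x₀ J := by
  refine le_dCost (exists_isTransportPath_sinkOn hcl hconv hn hy hx₀ J) fun w hw hbd => ?_
  have hK := convex_cylinder p v R
  have hcv : ‖-v‖ = 1 := by rwa [norm_neg]
  obtain ⟨w₁, hw₁, hb₁, hc₁, hK₁⟩ := exists_flow_mem ⟨x₀, hx₀c⟩ (isClosed_cylinder p v R) hK hα hα1
    hw (support_single_subset hx₀c _) (support_sinkOn_subset hyc J) hbd
  obtain ⟨w₂, hw₂, hb₂, hc₂, hs₂, hseg₂⟩ :=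
    exists_oneSided_subdivision hα hα1 _ (continuous_proj p v) σ₁ w₁ hw₁
  obtain ⟨w₃, hw₃, hb₃, hc₃, hs₃, hseg₃⟩ :=
    exists_oneSided_subdivision hα hα1 _ (continuous_proj p (-v)) σ₂ w₂ hw₂
  obtain ⟨w₄, hw₄, hb₄, hsub, hc₄, hr⟩ := exists_rigidFlow hα hα1 w₃ hw₃
  have hK₂ : ∀ e ∈ w₂.support, e.1 ∈ cylinder p v R ∧ e.2 ∈ cylinder p v R := by
    intro e he
    obtain ⟨e₀, he₀, h1, h2⟩ := hseg₂ e he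
    have := hK.segment_subset (hK₁ e₀ he₀).1 (hK₁ e₀ he₀).2
    exact ⟨this h1, this h2⟩
  have hK₄ : ∀ e ∈ w₄.support, e.1 ∈ cylinder p v R ∧ e.2 ∈ cylinder p v R := by
    intro e he
    obtain ⟨e₀, he₀, h1, h2⟩ := hseg₃ e (hsub he)
    have := hK.segment_subset (hK₂ e₀ he₀).1 (hK₂ e₀ he₀).2
    exact ⟨this h1, this h2⟩
  have hside : ∀ e ∈ w₄.support, OneSided (proj p v) σ₁ e := by
    intro e he
    obtain ⟨e₀, he₀, h1, h2⟩ := hseg₃ e (hsub he)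
    exact (hs₂ e₀ he₀).of_mem_segment h1 h2
  have hbd₄ : bdry w₄ = Finsupp.single x₀ (∑ j ∈ J, n j) - sinkOn y n J := by
    rw [hb₄, hb₃, hb₂, hb₁]
  have hM : 0 ≤ ∑ j ∈ J, n j := Finset.sum_nonneg fun j _ => hn j
  have h₁ := dCost_add_le_sum_sideLength hcl hconv hα hα1 hmα hv hR hw₄ hr hM
    (sinkOn_nonneg hn A₁) (sinkOn_mono hn hA₁) hbd₄ hσ₁ hK₄ hside hx₁ hx₁c (by
      intro z hz
      obtain ⟨j, hj, rfl⟩ := exists_of_mem_support_sinkOn hz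
      exact ⟨hy j, hyc j, hy₁ j hj⟩)
  rw [← cylinder_neg] at hx₂c
  simp only [← cylinder_neg p v] at hK₄ hyc
  have h₂ := dCost_add_le_sum_sideLength hcl hconv hα hα1 hmα hcv hR hw₄ hr hM
    (sinkOn_nonneg hn A₂) (sinkOn_mono hn hA₂) hbd₄ hσ₂ hK₄ (fun e he => hs₃ e (hsub he)) hx₂ hx₂c
    (by
      intro z hz
      obtain ⟨j, hj, rfl⟩ := exists_of_mem_support_sinkOn hz
      exact ⟨hy j, hyc j, hy₂ j hj⟩)
  rw [sum_sinkOn] at h₁ h₂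
  refine (add_le_add h₁ h₂).trans ?_
  refine le_trans ?_ (hc₄.trans (hc₃.trans (hc₂.trans hc₁)))
  rw [flowCost_eq_sum subset_rfl, ← Finset.sum_add_distrib]
  refine Finset.sum_le_sum fun e he => ?_
  rw [← mul_add]
  refine mul_le_mul_of_nonneg_left ?_ (phi_nonneg (hw₄ e))
  rw [proj_neg] at hσ₂ ⊢
  exact sideLength_add_sideLength_le hv hσ₁ hσ₂ (hside e he) (hs₃ e (hsub he))

theorem one_le_Cconst (hmα : ((m : ℝ) - 1) * (1 - α) < 1) : 1 ≤ Cconst m α := by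
  have : 1 < (2 : ℝ) ^ (1 - ((m : ℝ) - 1) * (1 - α)) :=
    Real.one_lt_rpow (by norm_num) (by linarith)
  have := div_nonneg (Real.sqrt_nonneg ((m : ℝ) - 1)) (sub_nonneg.2 this.le)
  unfold Cconst
  linarith

theorem exists_level {ι : Type*} {κ : Type*} {D t : ℝ} (hD : 0 ≤ D) {f : ι → ℝ} {g : κ → ℝ}
    {i i' : κ} (hi' : i' ≠ i) {A : Finset ι} (ht : ∀ j ∈ A, t < f j)
    (hfar : ∀ j ∈ A, ∃ r, r ≠ i ∧ 2 * D + |g r - f j| < |t - f j|) :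
    ∃ r, r ≠ i ∧ ∃ σ, t < σ ∧ (∀ j ∈ A, σ ≤ f j) ∧
      (A.Nonempty → 0 < σ - t - |g r - σ| - D) := by
  rcases A.eq_empty_or_nonempty with rfl | hA
  · exact ⟨i', hi', t + 1, by linarith, by simp, by simp⟩
  obtain ⟨j₀, hj₀, hmin⟩ := A.exists_min_image f hA
  obtain ⟨r, hr, hlt⟩ := hfar j₀ hj₀
  have h0 := ht j₀ hj₀
  rw [abs_of_neg (by linarith : t - f j₀ < 0)] at hlt
  refine ⟨r, hr, min (g r) (f j₀), ?_, fun j hj => (min_le_right _ _).trans (hmin j hj), fun _ => ?_⟩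
  · refine lt_min ?_ h0
    linarith [neg_abs_le (g r - f j₀)]
  · rcases le_total (g r) (f j₀) with h | h
    · rw [min_eq_left h, sub_self, abs_zero]
      linarith [neg_abs_le (g r - f j₀)]
    · rw [min_eq_right h]
      linarith

end Assign
/-- If `|π(x_i) − π(y_j)| > 2 C R + min_(i*≠i) |π(x_(i*)) − π(y_j)|`
for every household `j`, then no optimal assignment map assigns any household to
factory `i`. -/
theorem stmt_16 {m k ℓ : ℕ} (X : Set (Pt m)) (hXc : IsCompact X) (hXconv : Convex ℝ X)
    (α : ℝ) (hα0 : 0 ≤ α) (hα1 : α < 1)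
    (x : Fin k → Pt m) (hxinj : Function.Injective x) (hxX : ∀ i, x i ∈ X)
    (y : Fin ℓ → Pt m) (hyinj : Function.Injective y) (hyX : ∀ j, y j ∈ X)
    (n : Fin ℓ → ℝ) (hn : ∀ j, 0 < n j) (hnsum : ∑ j, n j = 1)
    (p v : Pt m) (hv : ‖v‖ = 1) (hmα : ((m : ℝ) - 1) * (1 - α) < 1)
    (hk : 2 ≤ k)
    (R : ℝ)
    (hR : IsGreatest ((fun z : Pt m => ‖z - p - proj p v z • v‖) ''
        (Set.range y ∪ Set.range x)) R)
    (i : Fin k)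
    (hfar : ∀ j : Fin ℓ, ∃ istar : Fin k, istar ≠ i ∧
      2 * Cconst m α * R + |proj p v (x istar) - proj p v (y j)| <
        |proj p v (x i) - proj p v (y j)|) :
    ∀ S : Fin ℓ → Fin k, IsOptimalAssign X α x y n S → ∀ j : Fin ℓ, S j ≠ i := by
  intro S hS j₁ hj₁
  have hcl := hXc.isClosed
  have hα1' : α ≤ 1 := hα1.le
  have hn' : ∀ j, 0 ≤ n j := fun j => (hn j).le
  have hyc : ∀ j, y j ∈ cylinder p v R := fun j =>
    hR.2 ⟨y j, Or.inl (Set.mem_range_self j), rfl⟩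
  have hxc : ∀ r, x r ∈ cylinder p v R := fun r =>
    hR.2 ⟨x r, Or.inr (Set.mem_range_self r), rfl⟩
  have hR0 : 0 ≤ R := (norm_nonneg _).trans (hxc i)
  have hD : 0 ≤ Cconst m α * R := mul_nonneg (zero_le_one.trans (one_le_Cconst hmα)) hR0
  simp only [mul_assoc] at hfar
  obtain ⟨i', hi', -⟩ := hfar j₁
  have hne : ∀ j, proj p v (y j) ≠ proj p v (x i) := by
    intro j hj
    obtain ⟨r, -, hr⟩ := hfar j
    rw [hj, sub_self, abs_zero] at hr
    linarith [abs_nonneg (proj p v (x r) - proj p v (x i))]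
  let J : Finset (Fin ℓ) := Finset.univ.filter fun j => S j = i
  let A₁ : Finset (Fin ℓ) := J.filter fun j => proj p v (x i) < proj p v (y j)
  let A₂ : Finset (Fin ℓ) := J.filter fun j => ¬ proj p v (x i) < proj p v (y j)
  obtain ⟨r₁, hr₁, σ₁, hσ₁, hy₁, hpos₁⟩ := exists_level (A := A₁) (t := proj p v (x i))
    (f := fun j => proj p v (y j)) (g := fun r => proj p v (x r)) hD hi'
    (fun j hj => (Finset.mem_filter.1 hj).2) (fun j _ => hfar j)
  obtain ⟨r₂, hr₂, σ₂, hσ₂, hy₂, hpos₂⟩ := exists_level (A := A₂) (t := proj p (-v) (x i))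
    (f := fun j => proj p (-v) (y j)) (g := fun r => proj p (-v) (x r)) hD hi'
    (fun j hj => by
      rw [proj_neg, proj_neg, neg_lt_neg_iff]
      exact lt_of_le_of_ne (not_lt.1 (Finset.mem_filter.1 hj).2) (hne j))
    (fun j _ => by
      obtain ⟨r, hr, hlt⟩ := hfar j
      refine ⟨r, hr, ?_⟩
      simp only [proj_neg, neg_sub_neg]
      rwa [abs_sub_comm (proj p v (y j)), abs_sub_comm (proj p v (y j))])
  have hkey := supplyCost_add_le hcl hXconv hα0 hα1' hmα hv hR0 hn' hyX hyc (hxX i) (hxX r₁)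
    (hxX r₂) (hxc i) (hxc r₁) (hxc r₂) hσ₁ hσ₂ (J := J) (Finset.filter_subset _ _)
    (Finset.filter_subset _ _) hy₁ hy₂
  have hphi : ∀ {A : Finset (Fin ℓ)}, A.Nonempty → 0 < phi α (∑ j ∈ A, n j) := fun hA =>
    phi_pos (Finset.sum_pos (fun j _ => hn j) hA)
  have hterm : ∀ {A : Finset (Fin ℓ)} {c : ℝ}, (A.Nonempty → 0 < c) →
      0 ≤ phi α (∑ j ∈ A, n j) * c := by
    intro A c h
    rcases A.eq_empty_or_nonempty with rfl | hA
    · simp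
    · exact (mul_pos (hphi hA) (h hA)).le
  have hlt : supplyCost X α y n (x r₁) A₁ + supplyCost X α y n (x r₂) A₂ <
      supplyCost X α y n (x i) J := by
    have t₁ := hterm hpos₁
    have t₂ := hterm hpos₂
    by_cases h : proj p v (x i) < proj p v (y j₁)
    · have hA : A₁.Nonempty := ⟨j₁, by simp [A₁, J, hj₁, h]⟩
      have := mul_pos (hphi hA) (hpos₁ hA)
      linarith
    · have hA : A₂.Nonempty := ⟨j₁, by simpa [A₂, J, hj₁] using h⟩
      have := mul_pos (hphi hA) (hpos₂ hA)
      linarith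
  let S' : Fin ℓ → Fin k := fun j =>
    if S j = i then (if proj p v (x i) < proj p v (y j) then r₁ else r₂) else S j
  have hbound : ∀ r, supplyCost X α y n (x r) (Finset.univ.filter fun j => S' j = r) ≤
      supplyCost X α y n (x r) (Finset.univ.filter fun j => S j = r) +
        (if r = r₁ then supplyCost X α y n (x r₁) A₁ else 0) +
        (if r = r₂ then supplyCost X α y n (x r₂) A₂ else 0) -
        (if r = i then supplyCost X α y n (x i) J else 0) := by
    intro r
    have hempty := supplyCost_empty_le (y := y) (n := n) hcl hXconv hα0 hα1' (hxX r)
    by_cases hri : r = i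
    · subst hri
      have : (Finset.univ.filter fun j => S' j = r) = ∅ := by
        rw [Finset.filter_eq_empty_iff]
        intro j _
        simp only [S']
        split_ifs with h1 h2
        · exact hr₁
        · exact hr₂
        · exact h1
      rw [this, if_neg hr₁.symm, if_neg hr₂.symm, if_pos rfl]
      simpa [J] using hempty
    · let B₁ : Finset (Fin ℓ) := if r = r₁ then A₁ else ∅
      let B₂ : Finset (Fin ℓ) := if r = r₂ then A₂ else ∅
      have hmem₁ : ∀ j, j ∈ B₁ ↔ r = r₁ ∧ S j = i ∧ proj p v (x i) < proj p v (y j) := by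
        intro j
        by_cases h : r = r₁ <;> simp [B₁, A₁, J, h]
      have hmem₂ : ∀ j, j ∈ B₂ ↔ r = r₂ ∧ S j = i ∧ ¬ proj p v (x i) < proj p v (y j) := by
        intro j
        by_cases h : r = r₂ <;> simp [B₂, A₂, J, h]
      have hF : (Finset.univ.filter fun j => S' j = r) =
          ((Finset.univ.filter fun j => S j = r) ∪ B₁) ∪ B₂ := by
        ext j
        simp only [Finset.mem_union, Finset.mem_filter, Finset.mem_univ, true_and, hmem₁, hmem₂, S']
        split_ifs with h1 h2
        · grind
        · grind
        · grind
      have hd₁ : Disjoint (Finset.univ.filter fun j => S j = r) B₁ := by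
        rw [Finset.disjoint_left]
        intro j hj hj'
        exact hri ((Finset.mem_filter.1 hj).2.symm.trans ((hmem₁ j).1 hj').2.1)
      have hd₂ : Disjoint ((Finset.univ.filter fun j => S j = r) ∪ B₁) B₂ := by
        rw [Finset.disjoint_left]
        intro j hj hj'
        rcases Finset.mem_union.1 hj with h | h
        · exact hri ((Finset.mem_filter.1 h).2.symm.trans ((hmem₂ j).1 hj').2.1)
        · exact ((hmem₂ j).1 hj').2.2 ((hmem₁ j).1 h).2.2
      have hB₁ : supplyCost X α y n (x r) B₁ ≤
          if r = r₁ then supplyCost X α y n (x r₁) A₁ else 0 := by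
        by_cases h : r = r₁
        · simp [B₁, h]
        · simpa [B₁, h] using hempty
      have hB₂ : supplyCost X α y n (x r) B₂ ≤
          if r = r₂ then supplyCost X α y n (x r₂) A₂ else 0 := by
        by_cases h : r = r₂
        · simp [B₂, h]
        · simpa [B₂, h] using hempty
      rw [hF, if_neg hri, sub_zero]
      exact (supplyCost_union_le hcl hXconv hα0 hα1' hn' hyX (hxX r) hd₂).trans
        (add_le_add ((supplyCost_union_le hcl hXconv hα0 hα1' hn' hyX (hxX r) hd₁).trans
          (add_le_add le_rfl hB₁)) hB₂)
  have hopt : ∑ r, supplyCost X α y n (x r) (Finset.univ.filter fun j => S j = r) ≤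
      ∑ r, supplyCost X α y n (x r) (Finset.univ.filter fun j => S' j = r) := hS S'
  have hsum := hopt.trans (Finset.sum_le_sum fun r _ => hbound r)
  simp only [Finset.sum_add_distrib, Finset.sum_sub_distrib, Finset.sum_ite_eq', Finset.mem_univ,
    if_true] at hsum
  linarith

end
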